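/- arXiv:1108.0458 — 4 statements merged into one kernel-verified Lean document; each statement's English description precedes it below -/
import Mathlib

section
/- The characteristic polynomial of A^ε equals ∏_{i=0}^{d} (X − θ^ε_i), where θ^ε_i = c·q^{2i−d} + c^{−1}·q^{d−2i} for 0 ≤ i ≤ d; that is, the roots of the characteristic polynomial of A^ε are exactly the scalars θ^ε_0, …, θ^ε_d. -/
/-- θ_i = a·q^{2i−d} + a^{−1}·q^{d−2i}. -/
noncomputable def qθ {K : Type*} [Field K] (d : ℕ) (a q : K) (i : ℕ) : K :=
  a * q ^ (2 * (i : ℤ) - (d : ℤ)) + a⁻¹ * q ^ ((d : ℤ) - 2 * (i : ℤ))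

/-- The first split sequence φ_i of QRacah type. -/
noncomputable def qφ {K : Type*} [Field K] (d : ℕ) (a b c q : K) (i : ℕ) : K :=
  a⁻¹ * b⁻¹ * q ^ ((d : ℤ) + 1) * (q ^ (i : ℤ) - q ^ (-(i : ℤ))) *
    (q ^ ((i : ℤ) - (d : ℤ) - 1) - q ^ ((d : ℤ) - (i : ℤ) + 1)) *
    (q ^ (-(i : ℤ)) - a * b * c * q ^ ((i : ℤ) - (d : ℤ) - 1)) *
    (q ^ (-(i : ℤ)) - a * b * c⁻¹ * q ^ ((i : ℤ) - (d : ℤ) - 1))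

/-- The second split sequence ϕ_i of QRacah type. -/
noncomputable def qϕ {K : Type*} [Field K] (d : ℕ) (a b c q : K) (i : ℕ) : K :=
  a * b⁻¹ * q ^ ((d : ℤ) + 1) * (q ^ (i : ℤ) - q ^ (-(i : ℤ))) *
    (q ^ ((i : ℤ) - (d : ℤ) - 1) - q ^ ((d : ℤ) - (i : ℤ) + 1)) *
    (q ^ (-(i : ℤ)) - a⁻¹ * b * c * q ^ ((i : ℤ) - (d : ℤ) - 1)) *
    (q ^ (-(i : ℤ)) - a⁻¹ * b * c⁻¹ * q ^ ((i : ℤ) - (d : ℤ) - 1))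

/-- Parameter array over 𝕂 of diameter d: conditions (PA1)–(PA5). -/
def IsParameterArray {K : Type*} [Field K] (d : ℕ) (θ θs φ ϕ : ℕ → K) : Prop :=
  (∀ i, i ≤ d → ∀ j, j ≤ d → i ≠ j → θ i ≠ θ j ∧ θs i ≠ θs j) ∧
  (∀ i, 1 ≤ i → i ≤ d → φ i ≠ 0 ∧ ϕ i ≠ 0) ∧
  (∀ i, 1 ≤ i → i ≤ d →
    φ i = ϕ 1 * (∑ h ∈ Finset.range i, (θ h - θ (d - h)) / (θ 0 - θ d)) +
      (θs i - θs 0) * (θ (i - 1) - θ d)) ∧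
  (∀ i, 1 ≤ i → i ≤ d →
    ϕ i = φ 1 * (∑ h ∈ Finset.range i, (θ h - θ (d - h)) / (θ 0 - θ d)) +
      (θs i - θs 0) * (θ (d - i + 1) - θ 0)) ∧
  (∃ β : K, ∀ i, 2 ≤ i → i + 1 ≤ d →
    (θ (i - 2) - θ (i + 1)) / (θ (i - 1) - θ i) = β ∧
    (θs (i - 2) - θs (i + 1)) / (θs (i - 1) - θs i) = β)

/-- The set QRAC_red: conditions (RQRAC1)–(RQRAC4). -/
def QRACred {K : Type*} [Field K] (d : ℕ) (a b c q : K) : Prop :=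
  (a ≠ 0 ∧ b ≠ 0 ∧ c ≠ 0 ∧ q ≠ 0) ∧
  (∀ i : ℕ, 1 ≤ i → i ≤ d → q ^ (2 * i) ≠ 1) ∧
  (∀ i : ℕ, 1 ≤ i → i ≤ 2 * d - 1 →
    a ^ 2 ≠ q ^ (2 * (d : ℤ) - 2 * (i : ℤ)) ∧ b ^ 2 ≠ q ^ (2 * (d : ℤ) - 2 * (i : ℤ))) ∧
  (∀ i : ℕ, 1 ≤ i → i ≤ d →
    a * b * c ≠ q ^ ((d : ℤ) - 2 * (i : ℤ) + 1) ∧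
    a⁻¹ * b * c ≠ q ^ ((d : ℤ) - 2 * (i : ℤ) + 1) ∧
    a * b⁻¹ * c ≠ q ^ ((d : ℤ) - 2 * (i : ℤ) + 1) ∧
    a * b * c⁻¹ ≠ q ^ ((d : ℤ) - 2 * (i : ℤ) + 1))

/-- The lower bidiagonal matrix A with A_{ii} = θ_i and A_{i,i−1} = 1. -/
noncomputable def matA {K : Type*} [Field K] (d : ℕ) (a q : K) :
    Matrix (Fin (d + 1)) (Fin (d + 1)) K :=
  Matrix.of fun i j =>
    if (i : ℕ) = (j : ℕ) then qθ d a q (i : ℕ)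
    else if (i : ℕ) = (j : ℕ) + 1 then 1 else 0

/-- The upper bidiagonal matrix A* with A*_{ii} = θ*_i and A*_{i−1,i} = φ_i. -/
noncomputable def matAs {K : Type*} [Field K] (d : ℕ) (a b c q : K) :
    Matrix (Fin (d + 1)) (Fin (d + 1)) K :=
  Matrix.of fun i j =>
    if (i : ℕ) = (j : ℕ) then qθ d b q (i : ℕ)
    else if (j : ℕ) = (i : ℕ) + 1 then qφ d a b c q (j : ℕ) else 0

/-- A^ε = (q^{−1}·A*A − q·AA*)/(q²−q^{−2})
      + ((a+a^{−1})(b+b^{−1}) + (c+c^{−1})(q^{d+1}+q^{−d−1}))/(q+q^{−1}) · I. -/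
noncomputable def matAe {K : Type*} [Field K] (d : ℕ) (a b c q : K) :
    Matrix (Fin (d + 1)) (Fin (d + 1)) K :=
  (q ^ 2 - q ^ (-2 : ℤ))⁻¹ •
      (q⁻¹ • (matAs d a b c q * matA d a q) - q • (matA d a q * matAs d a b c q)) +
    (((a + a⁻¹) * (b + b⁻¹) + (c + c⁻¹) * (q ^ ((d : ℤ) + 1) + q ^ (-(d : ℤ) - 1))) /
        (q + q⁻¹)) • (1 : Matrix (Fin (d + 1)) (Fin (d + 1)) K)

section AskeyWilsonCharpoly

variable {K : Type*} [Field K]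

namespace QRacah

lemma theta_eq (d : ℕ) (a : K) {q : K} (hq : q ≠ 0) (i : ℕ) :
    qθ d a q i = a * ((q ^ i) ^ 2 / q ^ d) + a⁻¹ * (q ^ d / (q ^ i) ^ 2) := by
  unfold qθ
  rw [zpow_sub₀ hq, zpow_sub₀ hq, mul_comm (2 : ℤ), zpow_mul]
  norm_cast

/-- A factor of `qφ`, used to rescale the basis in which `matA` and `matAs` are bidiagonal. -/
noncomputable def leftFactor (d : ℕ) (a b c q : K) (i : ℕ) : K :=
  q * a⁻¹ * (q ^ i / (q ^ d * q) - q ^ d * q / q ^ i) *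
    ((q ^ i)⁻¹ - a * b * c * (q ^ i / (q ^ d * q)))

/-- The factor of `qφ` complementary to `leftFactor`. -/
noncomputable def rightFactor (d : ℕ) (a b c q : K) (i : ℕ) : K :=
  b⁻¹ * q ^ d * (q ^ i - (q ^ i)⁻¹) * ((q ^ i)⁻¹ - a * b * c⁻¹ * (q ^ i / (q ^ d * q)))

lemma phi_eq (d : ℕ) (a b c : K) {q : K} (hq : q ≠ 0) (i : ℕ) :
    qφ d a b c q i = leftFactor d a b c q i * rightFactor d a b c q i := by
  unfold qφ leftFactor rightFactor
  have h1 : q ^ ((d : ℤ) + 1) = q ^ d * q := by rw [zpow_add₀ hq]; simp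
  have h2 : q ^ ((i : ℤ) - (d : ℤ) - 1) = q ^ i / (q ^ d * q) := by
    rw [zpow_sub₀ hq, zpow_sub₀ hq, div_div]; simp
  have h3 : q ^ ((d : ℤ) - (i : ℤ) + 1) = q ^ d * q / q ^ i := by
    rw [zpow_add₀ hq, zpow_sub₀ hq, div_mul_eq_mul_div]; simp
  rw [h1, h2, h3, zpow_neg, zpow_natCast]
  ring

lemma leftFactor_last (d : ℕ) (a b c : K) {q : K} (hq : q ≠ 0) :
    leftFactor d a b c q (d + 1) = 0 := by
  simp [leftFactor, ← pow_succ, hq]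

lemma phi_zero (d : ℕ) (a b c : K) {q : K} (hq : q ≠ 0) : qφ d a b c q 0 = 0 := by
  simp [phi_eq d a b c hq, rightFactor]

lemma phi_last (d : ℕ) (a b c : K) {q : K} (hq : q ≠ 0) : qφ d a b c q (d + 1) = 0 := by
  simp [phi_eq d a b c hq, leftFactor_last d a b c hq]

lemma leftFactor_ne_zero {d : ℕ} {a b c q : K} (h : QRACred d a b c q) {i : ℕ}
    (hi : 1 ≤ i) (hid : i ≤ d) : leftFactor d a b c q i ≠ 0 := by
  obtain ⟨⟨ha, hb, hc, hq⟩, h2, -, h4⟩ := h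
  have hQ := h2 (d + 1 - i) (by omega) (by omega)
  have hD : q ^ d * q = q ^ i * q ^ (d + 1 - i) := by
    rw [← pow_add, ← pow_succ]; congr 1; omega
  have habc := (h4 i hi hid).1
  have hx : q ^ i ≠ 0 := pow_ne_zero _ hq
  have hd : q ^ d ≠ 0 := pow_ne_zero _ hq
  unfold leftFactor
  refine mul_ne_zero (mul_ne_zero (mul_ne_zero hq (inv_ne_zero ha)) fun h0 => hQ ?_)
    fun h0 => habc ?_
  · have hy : q ^ (d + 1 - i) ≠ 0 := pow_ne_zero _ hq
    rw [hD] at h0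
    field_simp at h0
    rw [mul_comm 2, pow_mul]
    linear_combination -h0
  · have : q ^ ((d : ℤ) - 2 * (i : ℤ) + 1) = q ^ d * q / (q ^ i) ^ 2 := by
      rw [zpow_add₀ hq, zpow_sub₀ hq, mul_comm (2 : ℤ), zpow_mul, div_mul_eq_mul_div]
      norm_cast
      simp
    rw [this]
    field_simp at h0 ⊢
    linear_combination -h0

/-- The entry in column `j` of the `k`-th row of a rescaled Vandermonde matrix with nodes
`q ^ (2 * j)`. -/
noncomputable def row (d : ℕ) (a b c q : K) (k j : ℕ) : K :=
  (∏ l ∈ Finset.range j, leftFactor d a b c q (l + 1)) * (q ^ (2 * j)) ^ k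

lemma row_succ (d : ℕ) (a b c q : K) (k j : ℕ) :
    row d a b c q k (j + 1) =
      row d a b c q k j * (leftFactor d a b c q (j + 1) * (q ^ k) ^ 2) := by
  simp only [row, Finset.prod_range_succ]
  ring

lemma row_pred_mul_phi (d : ℕ) (a b c : K) {q : K} (hq : q ≠ 0) (k j : ℕ) :
    row d a b c q k (j - 1) * qφ d a b c q j =
      row d a b c q k j * (rightFactor d a b c q j / (q ^ k) ^ 2) := by
  rcases j with _ | j
  · simp [phi_zero d a b c hq, rightFactor]
  · have : q ^ k ≠ 0 := pow_ne_zero _ hq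
    rw [phi_eq d a b c hq, Nat.add_sub_cancel, row_succ]
    field_simp

lemma row_last (d : ℕ) (a b c : K) {q : K} (hq : q ≠ 0) (k : ℕ) :
    row d a b c q k (d + 1) = 0 := by
  simp [row_succ, leftFactor_last d a b c hq]

lemma sum_mul_matA (d : ℕ) (a q : K) (p : ℕ → K) (hp : p (d + 1) = 0) (j : Fin (d + 1)) :
    ∑ i : Fin (d + 1), p i * matA d a q i j = p j * qθ d a q j + p (j + 1) := by
  simp only [matA, Matrix.of_apply]
  rw [Fin.sum_univ_eq_sum_range
    (fun i => p i * if i = (j : ℕ) then qθ d a q i else if i = (j : ℕ) + 1 then 1 else 0)]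
  have hj := j.2
  have h1 : ∀ i, (p i * if i = (j : ℕ) then qθ d a q i else if i = (j : ℕ) + 1 then 1 else 0) =
      (if i = (j : ℕ) then p i * qθ d a q i else 0) + if i = (j : ℕ) + 1 then p i else 0 := by
    intro i
    split_ifs <;> simp_all
  simp only [h1, Finset.sum_add_distrib, Finset.sum_ite_eq', Finset.mem_range, hj, if_true]
  congr 1
  split_ifs with h
  · rfl
  · rw [show (j : ℕ) = d by omega, hp]

lemma sum_mul_matAs (d : ℕ) (a b c : K) {q : K} (hq : q ≠ 0) (p : ℕ → K) (j : Fin (d + 1)) :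
    ∑ i : Fin (d + 1), p i * matAs d a b c q i j =
      p j * qθ d b q j + p (j - 1) * qφ d a b c q j := by
  simp only [matAs, Matrix.of_apply]
  rw [Fin.sum_univ_eq_sum_range (fun i => p i * if i = (j : ℕ) then qθ d b q i
    else if (j : ℕ) = i + 1 then qφ d a b c q j else 0)]
  obtain ⟨j, hj⟩ := j
  rcases j with _ | j
  · simp [phi_zero d a b c hq]
  · have h1 : ∀ i, (p i * if i = j + 1 then qθ d b q i
        else if j + 1 = i + 1 then qφ d a b c q (j + 1) else 0) =
        (if i = j + 1 then p i * qθ d b q i else 0) +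
          if i = j then p i * qφ d a b c q (j + 1) else 0 := by
      intro i
      split_ifs <;> simp_all
    simp only [h1, Finset.sum_add_distrib, Finset.sum_ite_eq', Finset.mem_range, hj,
      Nat.lt_of_succ_lt hj, if_true, Nat.add_sub_cancel]

/-- The lower triangular matrix representing `matAe` in the rescaled Vandermonde basis. -/
noncomputable def lowerMatrix (d : ℕ) (a b c q : K) : Matrix (Fin (d + 1)) (Fin (d + 1)) K :=
  Matrix.of fun k l =>
    (if (l : ℕ) = k then qθ d c q k else 0) +
    (if (l : ℕ) + 1 = k then
      -((a * b * q)⁻¹ + c * q ^ d) * ((q ^ (k : ℕ)) ^ 2 - 1) -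
        ((q ^ d) ^ 2 * q / (a * b) + q ^ d / c) * (((q ^ (k : ℕ)) ^ 2)⁻¹ - 1) else 0) +
    (if (l : ℕ) + 2 = k then
      (q ^ d) ^ 2 / (a * b) * ((q ^ (k : ℕ)) ^ 2 / q + q / (q ^ (k : ℕ)) ^ 2 - q - q⁻¹) else 0)

lemma sum_ite_shift_mul {n k m : ℕ} (hk : k < n) (s y : K) (hy : y ≠ 0) (hs : k < m → s = 0) :
    ∑ l : Fin n, (if (l : ℕ) + m = k then s else 0) * y ^ (l : ℕ) = s * (y ^ k / y ^ m) := by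
  rw [Fin.sum_univ_eq_sum_range (fun l => (if l + m = k then s else 0) * y ^ l)]
  by_cases h : k < m
  · simp [hs h]
  · obtain ⟨r, rfl⟩ := Nat.exists_eq_add_of_le' (not_lt.mp h)
    have hr : r < n := by omega
    simp [hr, pow_add, hy]

lemma sum_lowerMatrix_mul (d : ℕ) (a b c : K) {q : K} (hq : q ≠ 0) (y : K) (hy : y ≠ 0)
    (k : Fin (d + 1)) :
    ∑ l, lowerMatrix d a b c q k l * y ^ (l : ℕ) =
      y ^ (k : ℕ) * (qθ d c q k +
      (-((a * b * q)⁻¹ + c * q ^ d) * ((q ^ (k : ℕ)) ^ 2 - 1) -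
        ((q ^ d) ^ 2 * q / (a * b) + q ^ d / c) * (((q ^ (k : ℕ)) ^ 2)⁻¹ - 1)) / y +
      ((q ^ d) ^ 2 / (a * b) *
        ((q ^ (k : ℕ)) ^ 2 / q + q / (q ^ (k : ℕ)) ^ 2 - q - q⁻¹)) / y ^ 2) := by
  have h0 := sum_ite_shift_mul (m := 0) k.2 (qθ d c q k) y hy (by simp)
  simp only [Nat.add_zero] at h0
  simp only [lowerMatrix, Matrix.of_apply, add_mul, Finset.sum_add_distrib]
  rw [h0, sum_ite_shift_mul k.2 _ y hy, sum_ite_shift_mul k.2 _ y hy]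
  · ring
  · intro hk
    have : (k : ℕ) = 0 ∨ (k : ℕ) = 1 := by omega
    rcases this with hk | hk <;> rw [hk] <;> field_simp <;> ring
  · intro hk
    rw [show (k : ℕ) = 0 by omega]
    simp

/-- The action of `matAe` on a row of the rescaled Vandermonde matrix, in terms of
`x = q ^ j`, `z = q ^ k` and `D = q ^ d`. -/
lemma rational_identity {a b c q x z D : K} (ha : a ≠ 0) (hb : b ≠ 0) (hc : c ≠ 0) (hq : q ≠ 0)
    (hx : x ≠ 0) (hz : z ≠ 0) (hD : D ≠ 0) (hq2 : q ^ 2 - 1 ≠ 0) (hq2' : q ^ 2 + 1 ≠ 0)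
    {f g f' t s t' s' t'' : K}
    (hf : f = q * a⁻¹ * (x * q / (D * q) - D * q / (x * q)) *
      ((x * q)⁻¹ - a * b * c * (x * q / (D * q))))
    (hf' : f' = b⁻¹ * D * (x * q - (x * q)⁻¹) * ((x * q)⁻¹ - a * b * c⁻¹ * (x * q / (D * q))))
    (hg : g = b⁻¹ * D * (x - x⁻¹) * (x⁻¹ - a * b * c⁻¹ * (x / (D * q))))
    (ht : t = a * (x ^ 2 / D) + a⁻¹ * (D / x ^ 2))
    (hs : s = b * (x ^ 2 / D) + b⁻¹ * (D / x ^ 2))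
    (ht' : t' = a * (x ^ 2 / (D * q ^ 2)) + a⁻¹ * (D * q ^ 2 / x ^ 2))
    (hs' : s' = b * (x ^ 2 * q ^ 2 / D) + b⁻¹ * (D / (x ^ 2 * q ^ 2)))
    (ht'' : t'' = c * (z ^ 2 / D) + c⁻¹ * (D / z ^ 2)) :
    (q ^ 2 - (q ^ 2)⁻¹)⁻¹ *
        (q⁻¹ * ((s + g / z ^ 2) * t + (f * z ^ 2 * s' + f * f')) -
          q * ((t + f * z ^ 2) * s + (g / z ^ 2 * t' +
            (q * a⁻¹ * (x / (D * q) - D * q / x) * (x⁻¹ - a * b * c * (x / (D * q)))) * g))) +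
      ((a + a⁻¹) * (b + b⁻¹) + (c + c⁻¹) * (D * q + (D * q)⁻¹)) / (q + q⁻¹) =
    t'' + (-((a * b * q)⁻¹ + c * D) * (z ^ 2 - 1) -
        (D ^ 2 * q / (a * b) + D / c) * ((z ^ 2)⁻¹ - 1)) / x ^ 2 +
      (D ^ 2 / (a * b) * (z ^ 2 / q + q / z ^ 2 - q - q⁻¹)) / (x ^ 2) ^ 2 := by
  have e1 : (q ^ 2 - (q ^ 2)⁻¹)⁻¹ = q ^ 2 / ((q ^ 2 - 1) * (q ^ 2 + 1)) := by
    rw [show (q ^ 2 - 1) * (q ^ 2 + 1) = q ^ 2 * (q ^ 2 - (q ^ 2)⁻¹) by field_simp; ring]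
    rw [div_mul_cancel_left₀ (pow_ne_zero _ hq)]
  have e2 : q + q⁻¹ = (q ^ 2 + 1) / q := by field_simp
  rw [e1, e2]
  subst hf hf' hg ht hs ht' hs' ht''
  field_simp
  ring

/-- The rescaled Vandermonde matrix with nodes `q ^ (2 * j)`. -/
noncomputable def rowMatrix (d : ℕ) (a b c q : K) : Matrix (Fin (d + 1)) (Fin (d + 1)) K :=
  Matrix.of fun k j => row d a b c q k j

lemma rowMatrix_mul_matA_mul_matAs_apply (d : ℕ) (a b c : K) {q : K} (hq : q ≠ 0)
    (k j : Fin (d + 1)) :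
    (rowMatrix d a b c q * (matA d a q * matAs d a b c q)) k j =
      (row d a b c q k j * qθ d a q j + row d a b c q k (j + 1)) * qθ d b q j +
        (row d a b c q k (j - 1) * qθ d a q (j - 1) + row d a b c q k (j - 1 + 1)) *
          qφ d a b c q j := by
  rw [← Matrix.mul_assoc, Matrix.mul_apply,
    ← sum_mul_matAs d a b c hq (fun i => row d a b c q k i * qθ d a q i + row d a b c q k (i + 1))]
  refine Finset.sum_congr rfl fun i _ => ?_
  rw [Matrix.mul_apply, ← sum_mul_matA d a q (row d a b c q k) (row_last d a b c hq k)]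
  rfl

lemma rowMatrix_mul_matAs_mul_matA_apply (d : ℕ) (a b c : K) {q : K} (hq : q ≠ 0)
    (k j : Fin (d + 1)) :
    (rowMatrix d a b c q * (matAs d a b c q * matA d a q)) k j =
      (row d a b c q k j * qθ d b q j + row d a b c q k (j - 1) * qφ d a b c q j) * qθ d a q j +
        (row d a b c q k (j + 1) * qθ d b q (j + 1) +
          row d a b c q k j * qφ d a b c q (j + 1)) := by
  have h := sum_mul_matA d a q
    (fun i => row d a b c q k i * qθ d b q i + row d a b c q k (i - 1) * qφ d a b c q i)
    (by simp [row_last d a b c hq, phi_last d a b c hq]) j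
  simp only [Nat.add_sub_cancel] at h
  rw [← Matrix.mul_assoc, Matrix.mul_apply, ← h]
  refine Finset.sum_congr rfl fun i _ => ?_
  rw [Matrix.mul_apply, ← sum_mul_matAs d a b c hq (row d a b c q k)]
  rfl

lemma row_pred_term (d : ℕ) (a b c : K) {q : K} (hq : q ≠ 0) (k j : ℕ) :
    (row d a b c q k (j - 1) * qθ d a q (j - 1) + row d a b c q k (j - 1 + 1)) * qφ d a b c q j =
      row d a b c q k j * (rightFactor d a b c q j / (q ^ k) ^ 2 *
        (a * ((q ^ j) ^ 2 / (q ^ d * q ^ 2)) + a⁻¹ * (q ^ d * q ^ 2 / (q ^ j) ^ 2)) +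
        leftFactor d a b c q j * rightFactor d a b c q j) := by
  rcases j with _ | j
  · simp [phi_zero d a b c hq, rightFactor]
  · have h := row_pred_mul_phi d a b c hq k (j + 1)
    have hθ : qθ d a q j = a * ((q ^ (j + 1)) ^ 2 / (q ^ d * q ^ 2)) +
        a⁻¹ * (q ^ d * q ^ 2 / (q ^ (j + 1)) ^ 2) := by
      rw [theta_eq d a hq, pow_succ q j, mul_pow]
      field_simp
    rw [Nat.add_sub_cancel] at h ⊢
    rw [← hθ, ← phi_eq d a b c hq]
    linear_combination qθ d a q j * h

lemma sq_ne_one_and_ne_neg_one {d : ℕ} (hd : 3 ≤ d) {a b c q : K} (h : QRACred d a b c q) :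
    q ^ 2 - 1 ≠ 0 ∧ q ^ 2 + 1 ≠ 0 := by
  have h2 := h.2.1 2 (by omega) (by omega)
  constructor <;> intro h0 <;> apply h2
  · linear_combination (q ^ 2 + 1) * h0
  · linear_combination (q ^ 2 - 1) * h0

lemma rowMatrix_mul_matAe {d : ℕ} (hd : 3 ≤ d) {a b c q : K} (h : QRACred d a b c q) :
    rowMatrix d a b c q * matAe d a b c q = lowerMatrix d a b c q * rowMatrix d a b c q := by
  obtain ⟨hq2, hq2'⟩ := sq_ne_one_and_ne_neg_one hd h
  obtain ⟨⟨ha, hb, hc, hq⟩, -⟩ := h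
  ext k j
  have hR : (lowerMatrix d a b c q * rowMatrix d a b c q) k j =
      (∏ l ∈ Finset.range j, leftFactor d a b c q (l + 1)) *
        ∑ l, lowerMatrix d a b c q k l * (q ^ (2 * (j : ℕ))) ^ (l : ℕ) := by
    rw [Matrix.mul_apply, Finset.mul_sum]
    refine Finset.sum_congr rfl fun l _ => ?_
    simp only [rowMatrix, row, Matrix.of_apply]
    ring
  rw [hR, sum_lowerMatrix_mul d a b c hq _ (pow_ne_zero _ hq), ← mul_assoc]
  change _ = row d a b c q k j * _
  have key := rational_identity (x := q ^ (j : ℕ)) (z := q ^ (k : ℕ)) (D := q ^ d) ha hb hc hq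
    (pow_ne_zero _ hq) (pow_ne_zero _ hq) (pow_ne_zero _ hq) hq2 hq2'
    (f := leftFactor d a b c q (j + 1)) (f' := rightFactor d a b c q (j + 1))
    (g := rightFactor d a b c q j) (t := qθ d a q j) (s := qθ d b q j)
    (s' := qθ d b q (j + 1)) (t'' := qθ d c q k)
    (by rw [leftFactor, pow_succ]) (by rw [rightFactor, pow_succ]) rfl
    (theta_eq d a hq j) (theta_eq d b hq j) rfl
    (by rw [theta_eq d b hq, pow_succ q j, mul_pow]) (theta_eq d c hq k)
  have hmul : (q ^ (2 * (j : ℕ))) = (q ^ (j : ℕ)) ^ 2 := by rw [mul_comm, pow_mul]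
  have hz1 : q ^ (-2 : ℤ) = (q ^ 2)⁻¹ := by rw [zpow_neg]; norm_cast
  have hz2 : q ^ ((d : ℤ) + 1) = q ^ d * q := by rw [zpow_add₀ hq]; simp
  have hz3 : q ^ (-(d : ℤ) - 1) = (q ^ d * q)⁻¹ := by
    rw [← hz2, ← zpow_neg]; congr 1; ring
  rw [hmul, ← key]
  simp only [matAe, Matrix.mul_add, Matrix.mul_sub, Matrix.mul_smul, Matrix.mul_one,
    Matrix.add_apply, Matrix.sub_apply, Matrix.smul_apply, smul_eq_mul]
  rw [rowMatrix_mul_matA_mul_matAs_apply d a b c hq, rowMatrix_mul_matAs_mul_matA_apply d a b c hq,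
    row_pred_term d a b c hq, row_pred_mul_phi d a b c hq, phi_eq d a b c hq, row_succ,
    hz1, hz2, hz3, show rowMatrix d a b c q k j = row d a b c q k j from rfl,
    show leftFactor d a b c q j = q * a⁻¹ * (q ^ (j : ℕ) / (q ^ d * q) - q ^ d * q / q ^ (j : ℕ)) *
      ((q ^ (j : ℕ))⁻¹ - a * b * c * (q ^ (j : ℕ) / (q ^ d * q))) from rfl]
  ring

lemma isUnit_rowMatrix {d : ℕ} {a b c q : K} (h : QRACred d a b c q) :
    IsUnit (rowMatrix d a b c q) := by
  have hq : q ≠ 0 := h.1.2.2.2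
  have hfac : rowMatrix d a b c q =
      (Matrix.vandermonde fun j : Fin (d + 1) => q ^ (2 * (j : ℕ))).transpose *
        Matrix.diagonal fun j : Fin (d + 1) =>
          ∏ l ∈ Finset.range j, leftFactor d a b c q (l + 1) := by
    ext k j
    simp [rowMatrix, row, Matrix.mul_diagonal, Matrix.vandermonde_apply, mul_comm]
  have hinj : ∀ i j : ℕ, i < j → j ≤ d → q ^ (2 * i) ≠ q ^ (2 * j) := by
    intro i j hij hj he
    refine h.2.1 (j - i) (by omega) (by omega) (mul_left_cancel₀ (pow_ne_zero (2 * i) hq) ?_)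
    rw [← pow_add, mul_one, he]
    congr 1
    omega
  rw [Matrix.isUnit_iff_isUnit_det, isUnit_iff_ne_zero, hfac, Matrix.det_mul,
    Matrix.det_transpose, Matrix.det_diagonal]
  refine mul_ne_zero (Matrix.det_vandermonde_ne_zero_iff.mpr fun i j hij => ?_)
    (Finset.prod_ne_zero_iff.mpr fun j _ => Finset.prod_ne_zero_iff.mpr fun l hl => ?_)
  · rcases lt_trichotomy (i : ℕ) j with hlt | heq | hgt
    · exact absurd hij (hinj _ _ hlt (Nat.lt_succ_iff.mp j.2))
    · exact Fin.ext heq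
    · exact absurd hij.symm (hinj _ _ hgt (Nat.lt_succ_iff.mp i.2))
  · have := Finset.mem_range.mp hl
    exact leftFactor_ne_zero h (by omega) (by omega)

open Polynomial in
lemma charpoly_lowerMatrix (d : ℕ) (a b c q : K) :
    (lowerMatrix d a b c q).charpoly = ∏ i : Fin (d + 1), (X - C (qθ d c q i)) := by
  have hT : (lowerMatrix d a b c q).transpose.IsUpperTriangular := by
    intro i j hij
    have : (j : ℕ) < i := hij
    simp only [lowerMatrix, Matrix.transpose_apply, Matrix.of_apply]
    rw [if_neg (by omega), if_neg (by omega), if_neg (by omega)]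
    simp
  rw [← Matrix.charpoly_transpose, Matrix.charpoly_of_isUpperTriangular _ hT]
  simp [lowerMatrix]

end QRacah

end AskeyWilsonCharpoly

/-- Corollary 12.8: the characteristic polynomial of A^ε is
∏_{i=0}^d (X − θ^ε_i) with θ^ε_i = c·q^{2i−d} + c^{−1}·q^{d−2i}. -/
theorem stmt_13 {K : Type*} [Field K] [IsAlgClosed K] (d : ℕ) (hd : 3 ≤ d)
    (a b c q : K) (h : QRACred d a b c q) :
    (matAe d a b c q).charpoly =
      ∏ i : Fin (d + 1), (Polynomial.X - Polynomial.C (qθ d c q (i : ℕ))) := by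
  have hU := QRacah.isUnit_rowMatrix h
  rw [← QRacah.charpoly_lowerMatrix d a b c q, ← Matrix.charpoly_units_conj hU.unit,
    IsUnit.unit_spec, QRacah.rowMatrix_mul_matAe hd h, Matrix.mul_nonsing_inv_cancel_right]
  exact (Matrix.isUnit_iff_isUnit_det _).mp hU
end

section
/- The following are equivalent: (i) A^ε is multiplicity-free, i.e. A^ε has d+1 mutually distinct eigenvalues; (ii) the scalars θ^ε_i = c·q^{2i−d} + c^{−1}·q^{d−2i} (0 ≤ i ≤ d) are mutually distinct; (iii) c² ≠ q^{2d−2i} for all 1 ≤ i ≤ 2d−1. -/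
/-- A matrix over 𝕂 is multiplicity-free when its characteristic polynomial has
d+1 mutually distinct roots. -/
def MultFree {K : Type*} [Field K] {n : ℕ} (X : Matrix (Fin n) (Fin n) K) : Prop :=
  ∃ e : Fin n → K, Function.Injective e ∧
    X.charpoly = ∏ i : Fin n, (Polynomial.X - Polynomial.C (e i))

lemma qθ_eq_pow {K : Type*} [Field K] {q : K} (hq : q ≠ 0) (d : ℕ) (a : K) (i : ℕ) :
    qθ d a q i = a * (q ^ i) ^ 2 / q ^ d + a⁻¹ * q ^ d / (q ^ i) ^ 2 := by
  simp only [qθ, zpow_sub₀ hq, zpow_mul, zpow_natCast, mul_comm (2 : ℤ)]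
  norm_cast
  ring

lemma qφ_eq_pow {K : Type*} [Field K] {q : K} (hq : q ≠ 0) (d : ℕ) (a b c : K) (i : ℕ) :
    qφ d a b c q i = a⁻¹ * b⁻¹ * (q ^ d * q) * (q ^ i - (q ^ i)⁻¹) *
      (q ^ i / q ^ d / q - q ^ d / q ^ i * q) *
      ((q ^ i)⁻¹ - a * b * c * (q ^ i / q ^ d / q)) *
      ((q ^ i)⁻¹ - a * b * c⁻¹ * (q ^ i / q ^ d / q)) := by
  simp only [qφ, zpow_sub₀ hq, zpow_add₀ hq, zpow_neg, zpow_natCast, zpow_one]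

/-- `qφ` with the factor involving `c⁻¹` replaced by a power of `q`: the superdiagonal entries
of an upper bidiagonal matrix similar to `matAe`. -/
noncomputable def splitSuper {K : Type*} [Field K] (d : ℕ) (a b c q : K) (k : ℕ) : K :=
  a⁻¹ * b⁻¹ * (q ^ d * q ^ 2 / q ^ k) * (q ^ k - (q ^ k)⁻¹) *
    (q ^ k / q ^ d / q - q ^ d / q ^ k * q) *
    ((q ^ k)⁻¹ - a * b * c * (q ^ k / q ^ d / q))

/-- The reciprocal `q²`-factorial of `i - k`, extended by zero to `i < k`. -/
noncomputable def invQFactorial {K : Type*} [Field K] (q : K) (i k : ℕ) : K :=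
  if k ≤ i then ∏ h ∈ Finset.range (i - k), (1 - q ^ (2 * (h + 1)))⁻¹ else 0

lemma invQFactorial_succ_succ {K : Type*} [Field K] (q : K) (i k : ℕ) :
    invQFactorial q (i + 1) (k + 1) = invQFactorial q i k := by
  simp [invQFactorial]

lemma invQFactorial_of_lt {K : Type*} [Field K] (q : K) {i k : ℕ} (h : i < k) :
    invQFactorial q i k = 0 := by
  simp [invQFactorial, h]

lemma invQFactorial_eq_mul_succ {K : Type*} [Field K] {q : K} (hq : q ≠ 0) {i k : ℕ}
    (h : k ≤ i → q ^ (2 * (i - k + 1)) ≠ 1) :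
    invQFactorial q i k = (1 - q ^ 2 * (q ^ i) ^ 2 / (q ^ k) ^ 2) * invQFactorial q (i + 1) k := by
  rcases lt_trichotomy k (i + 1) with hk | rfl | hk
  · obtain ⟨m, rfl⟩ := Nat.exists_eq_add_of_le (Nat.lt_succ_iff.mp hk)
    have h1 := h (by omega)
    have e1 : k + m - k = m := by omega
    have e2 : k + m + 1 - k = m + 1 := by omega
    rw [e1] at h1
    have h2 : (1 : K) - q ^ (2 * (m + 1)) ≠ 0 := sub_ne_zero.mpr (Ne.symm h1)
    have h3 : q ^ 2 * (q ^ (k + m)) ^ 2 / (q ^ k) ^ 2 = q ^ (2 * (m + 1)) := by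
      field_simp
      ring
    simp only [invQFactorial, e1, e2, h3, Finset.prod_range_succ]
    rw [if_pos (by omega), if_pos (by omega)]
    field_simp
  · rw [invQFactorial_of_lt q (Nat.lt_succ_self i)]
    have h3 : q ^ 2 * (q ^ i) ^ 2 / (q ^ (i + 1)) ^ 2 = 1 := by
      field_simp
      ring
    rw [h3]
    simp
  · rw [invQFactorial_of_lt q hk, invQFactorial_of_lt q (by omega), mul_zero]

/-- Row scaling of the matrix that triangularizes `matAe`. -/
noncomputable def rowScale {K : Type*} [Field K] (d : ℕ) (a b c q : K) (i : ℕ) : K :=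
  ∏ h ∈ Finset.range i,
    (-a * q ^ (h + 1) / q ^ d / ((q ^ (h + 1))⁻¹ - a * b * c⁻¹ * (q ^ (h + 1) / q ^ d / q)))

lemma rowScale_succ {K : Type*} [Field K] (d : ℕ) (a b c q : K) (i : ℕ) :
    rowScale d a b c q (i + 1) = rowScale d a b c q i * (-a * q ^ (i + 1) / q ^ d /
      ((q ^ (i + 1))⁻¹ - a * b * c⁻¹ * (q ^ (i + 1) / q ^ d / q))) :=
  Finset.prod_range_succ ..

/-- A lower triangular matrix conjugating `matAe` to an upper bidiagonal matrix. -/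
noncomputable def triMat {K : Type*} [Field K] (d : ℕ) (a b c q : K) :
    Matrix (Fin (d + 1)) (Fin (d + 1)) K :=
  Matrix.of fun i k => rowScale d a b c q i * invQFactorial q i k

/-- The upper bidiagonal matrix similar to `matAe`. -/
noncomputable def splitMat {K : Type*} [Field K] (d : ℕ) (a b c q : K) :
    Matrix (Fin (d + 1)) (Fin (d + 1)) K :=
  Matrix.of fun i j =>
    if (i : ℕ) = (j : ℕ) then qθ d c q (i : ℕ)
    else if (j : ℕ) = (i : ℕ) + 1 then splitSuper d a b c q (j : ℕ) else 0

/-- The entrywise form of `QRACred.matAe_mul_triMat`, with `x = q ^ i`, `y = q ^ k`, `D = q ^ d`. -/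
lemma matAe_triMat_entry_identity {K : Type*} [Field K] {a b c q x y D p h : K}
    (ha : a ≠ 0) (hb : b ≠ 0) (hc : c ≠ 0) (hq : q ≠ 0) (hx : x ≠ 0) (hy : y ≠ 0) (hD : D ≠ 0)
    (hq4 : q ^ 4 - 1 ≠ 0) (hq2 : q ^ 2 + 1 ≠ 0)
    (hp : p = (1 - q ^ 2 * x ^ 2 / y ^ 2) * h ∨ x = D ∧ y = 1)
    {pm f : K}
    (hpm : pm = -a⁻¹ * D / x * (x⁻¹ - a * b * c⁻¹ * (x / D / q)) * (1 - x ^ 2 / y ^ 2) * p)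
    (hf : f = -b⁻¹ * (x * q ^ 2) * (x * q - (x * q)⁻¹) * (x / D - D / x) *
      ((x * q)⁻¹ - a * b * c * (x / D)) * h)
    {φ φ' t ts t' tm β tc : K}
    (hφ : φ = a⁻¹ * b⁻¹ * (D * q) * (x - x⁻¹) * (x / D / q - D / x * q) *
      (x⁻¹ - a * b * c * (x / D / q)) * (x⁻¹ - a * b * c⁻¹ * (x / D / q)))
    (hφ' : φ' = a⁻¹ * b⁻¹ * (D * q) * (x * q - (x * q)⁻¹) * (x / D - D / x) *
      ((x * q)⁻¹ - a * b * c * (x / D)) * ((x * q)⁻¹ - a * b * c⁻¹ * (x / D)))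
    (ht : t = a * x ^ 2 / D + a⁻¹ * D / x ^ 2)
    (hts : ts = b * x ^ 2 / D + b⁻¹ * D / x ^ 2)
    (ht' : t' = a * (x * q) ^ 2 / D + a⁻¹ * D / (x * q) ^ 2)
    (htm : tm = b * (x / q) ^ 2 / D + b⁻¹ * D / (x / q) ^ 2)
    (htc : tc = c * y ^ 2 / D + c⁻¹ * D / y ^ 2)
    (hβ : β = a⁻¹ * b⁻¹ * (D * q ^ 2 / y) * (y - y⁻¹) * (y / D / q - D / y * q) *
      (y⁻¹ - a * b * c * (y / D / q))) :
    (q ^ 2 - (q ^ 2)⁻¹)⁻¹ * (q⁻¹ * (ts * (t * p + pm) + (t' * f + φ' * p)) -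
        q * (t * (ts * p + f) + (tm * pm + φ * p))) +
      ((a + a⁻¹) * (b + b⁻¹) + (c + c⁻¹) * (D * q + D⁻¹ / q)) / (q + q⁻¹) * p =
    tc * p + β * h := by
  have e1 : (q ^ 2 - (q ^ 2)⁻¹)⁻¹ = q ^ 2 / (q ^ 4 - 1) := by
    rw [inv_eq_iff_eq_inv, inv_div]
    field_simp
  have e2 : (q + q⁻¹) = (q ^ 2 + 1) / q := by
    field_simp
  have e3 : q ^ 4 - 1 = (q ^ 2 - 1) * (q ^ 2 + 1) := by ring
  have e4 : q ^ 2 - 1 ≠ 0 := fun h0 => hq4 (by rw [e3, h0, zero_mul])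
  rw [e1, e2, e3]
  rcases hp with hp | ⟨rfl, rfl⟩
  · subst hpm hf hφ hφ' ht hts ht' htm htc hβ
    rw [hp]
    field_simp
    ring
  · subst hpm hf hφ hφ' ht hts ht' htm htc hβ
    field_simp
    ring

lemma sum_lower_bidiagonal {K : Type*} [Field K] {d : ℕ} (p r v : ℕ → K) (i : Fin (d + 1)) :
    ∑ j : Fin (d + 1), (if (i : ℕ) = (j : ℕ) then p i else if (i : ℕ) = (j : ℕ) + 1 then r i
      else 0) * v j = p i * v i + if (i : ℕ) = 0 then 0 else r i * v (i - 1) := by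
  obtain ⟨i, hi⟩ := i
  simp only
  rw [Fin.sum_univ_eq_sum_range
    (fun j => (if i = j then p i else if i = j + 1 then r i else 0) * v j)]
  rcases i with _ | i
  · rw [Finset.sum_eq_single 0] <;> grind
  · rw [← Finset.sum_subset (s₁ := {i + 1, i}), Finset.sum_pair] <;> grind

lemma sum_upper_bidiagonal {K : Type*} [Field K] {d : ℕ} (p s v : ℕ → K) (i : Fin (d + 1)) :
    ∑ j : Fin (d + 1), (if (i : ℕ) = (j : ℕ) then p i else if (j : ℕ) = (i : ℕ) + 1 then s j
      else 0) * v j = p i * v i + if (i : ℕ) = d then 0 else s (i + 1) * v (i + 1) := by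
  obtain ⟨i, hi⟩ := i
  simp only
  rw [Fin.sum_univ_eq_sum_range
    (fun j => (if i = j then p i else if j = i + 1 then s j else 0) * v j)]
  by_cases hid : i = d
  · rw [Finset.sum_eq_single i] <;> grind
  · rw [← Finset.sum_subset (s₁ := {i, i + 1}), Finset.sum_pair] <;> grind

lemma sum_mul_upper_bidiagonal {K : Type*} [Field K] {d : ℕ} (p s v : ℕ → K) (k : Fin (d + 1)) :
    ∑ j : Fin (d + 1), v j * (if (j : ℕ) = (k : ℕ) then p j else if (k : ℕ) = (j : ℕ) + 1 then s k
      else 0) = v k * p k + if (k : ℕ) = 0 then 0 else v (k - 1) * s k := by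
  rw [show v k * p k = p k * v k by ring,
    show v (k - 1) * s k = s k * v (k - 1) by ring, ← sum_lower_bidiagonal p s v k]
  refine Finset.sum_congr rfl fun j _ => ?_
  grind

lemma matA_mul_apply {K : Type*} [Field K] {d : ℕ} (a q : K)
    (X : Matrix (Fin (d + 1)) (Fin (d + 1)) K) (v : ℕ → K) (i k : Fin (d + 1))
    (hv : ∀ j : Fin (d + 1), X j k = v j) :
    (matA d a q * X) i k = qθ d a q i * v i + if (i : ℕ) = 0 then 0 else v (i - 1) := by
  rw [Matrix.mul_apply, ← one_mul (v (i - 1))]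
  simp only [hv]
  exact sum_lower_bidiagonal (qθ d a q) (fun _ => 1) v i

lemma matAs_mul_apply {K : Type*} [Field K] {d : ℕ} (a b c q : K)
    (X : Matrix (Fin (d + 1)) (Fin (d + 1)) K) (v : ℕ → K) (i k : Fin (d + 1))
    (hv : ∀ j : Fin (d + 1), X j k = v j) :
    (matAs d a b c q * X) i k = qθ d b q i * v i +
      if (i : ℕ) = d then 0 else qφ d a b c q (i + 1) * v (i + 1) := by
  rw [Matrix.mul_apply]
  simp only [hv]
  exact sum_upper_bidiagonal (qθ d b q) (qφ d a b c q) v i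

lemma QRACred.super_factor_ne_zero {K : Type*} [Field K] {d : ℕ} {a b c q : K}
    (h : QRACred d a b c q) {i : ℕ} (hi : i < d) :
    (q ^ (i + 1))⁻¹ - a * b * c⁻¹ * (q ^ (i + 1) / q ^ d / q) ≠ 0 := by
  obtain ⟨⟨ha, hb, hc, hq⟩, -, -, h4⟩ := h
  intro h0
  apply (h4 (i + 1) (by omega) (by omega)).2.2.2
  have e : q ^ ((d : ℤ) - 2 * ((i + 1 : ℕ) : ℤ) + 1) = q ^ d * q / (q ^ (i + 1)) ^ 2 := by
    rw [zpow_add₀ hq, zpow_sub₀ hq, mul_comm (2 : ℤ), zpow_mul]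
    simp only [zpow_natCast, zpow_one]
    norm_cast
    ring
  rw [e]
  rw [sub_eq_zero] at h0
  have : a * b * c⁻¹ = (q ^ (i + 1))⁻¹ / (q ^ (i + 1) / q ^ d / q) := by
    rw [h0]
    field_simp
  rw [this]
  field_simp

lemma QRACred.rowScale_ne_zero {K : Type*} [Field K] {d : ℕ} {a b c q : K}
    (h : QRACred d a b c q) {i : ℕ} (hi : i ≤ d) : rowScale d a b c q i ≠ 0 := by
  have ha := h.1.1
  have hq := h.1.2.2.2
  rw [rowScale, Finset.prod_ne_zero_iff]
  intro j hj
  have := h.super_factor_ne_zero (i := j) (by grind)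
  exact div_ne_zero (div_ne_zero (mul_ne_zero (neg_ne_zero.mpr ha) (pow_ne_zero _ hq))
    (pow_ne_zero _ hq)) this

lemma QRACred.matAe_mul_triMat {K : Type*} [Field K] {d : ℕ} (hd : 3 ≤ d) {a b c q : K}
    (h : QRACred d a b c q) :
    matAe d a b c q * triMat d a b c q = triMat d a b c q * splitMat d a b c q := by
  have ⟨⟨ha, hb, hc, hq⟩, h2, _, _⟩ := h
  have hq4 : q ^ 4 - 1 ≠ 0 := sub_ne_zero.mpr (h2 2 (by omega) (by omega))
  have hq2 : q ^ 2 + 1 ≠ 0 := by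
    intro h0
    apply hq4
    linear_combination (q ^ 2 - 1) * h0
  ext i k
  have hi : (i : ℕ) ≤ d := by omega
  set P : ℕ → ℕ → K := fun i k => rowScale d a b c q i * invQFactorial q i k with hP
  have hA := fun i => matA_mul_apply a q (triMat d a b c q) (fun j => P j k) i k fun _ => rfl
  have hAs := fun i => matAs_mul_apply a b c q (triMat d a b c q) (fun j => P j k) i k fun _ => rfl
  have hAsA := matAs_mul_apply a b c q (matA d a q * triMat d a b c q)
    (fun j => qθ d a q j * P j k + if j = 0 then 0 else P (j - 1) k) i k hA
  have hAAs := matA_mul_apply a q (matAs d a b c q * triMat d a b c q)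
    (fun j => qθ d b q j * P j k + if j = d then 0 else qφ d a b c q (j + 1) * P (j + 1) k) i k hAs
  have hR : (triMat d a b c q * splitMat d a b c q) i k =
      P i k * qθ d c q k + if (k : ℕ) = 0 then 0 else P i (k - 1) * splitSuper d a b c q k := by
    rw [Matrix.mul_apply]
    exact sum_mul_upper_bidiagonal (qθ d c q) (splitSuper d a b c q) (fun j => P i j) k
  have hL : (matAe d a b c q * triMat d a b c q) i k = (q ^ 2 - (q ^ 2)⁻¹)⁻¹ *
      (q⁻¹ * (matAs d a b c q * (matA d a q * triMat d a b c q)) i k -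
        q * (matA d a q * (matAs d a b c q * triMat d a b c q)) i k) +
      ((a + a⁻¹) * (b + b⁻¹) + (c + c⁻¹) * (q ^ d * q + (q ^ d)⁻¹ / q)) / (q + q⁻¹) * P i k := by
    have e1 : q ^ (-2 : ℤ) = (q ^ 2)⁻¹ := by
      rw [zpow_neg]
      norm_cast
    have e2 : q ^ ((d : ℤ) + 1) = q ^ d * q := by
      rw [zpow_add₀ hq, zpow_natCast, zpow_one]
    have e3 : q ^ (-(d : ℤ) - 1) = (q ^ d)⁻¹ / q := by
      rw [zpow_sub₀ hq, zpow_neg, zpow_natCast, zpow_one]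
    rw [matAe, e1, e2, e3]
    simp only [Matrix.add_mul, Matrix.smul_mul, Matrix.sub_mul, Matrix.mul_assoc, Matrix.one_mul,
      Matrix.add_apply, Matrix.smul_apply, Matrix.sub_apply, smul_eq_mul]
    rfl
  rw [hL, hR, hAsA, hAAs]
  obtain ⟨i, hi'⟩ := i
  obtain ⟨k, hk⟩ := k
  simp only at hi ⊢
  have hx : q ^ i ≠ 0 := pow_ne_zero _ hq
  have hy : q ^ k ≠ 0 := pow_ne_zero _ hq
  have hD : q ^ d ≠ 0 := pow_ne_zero _ hq
  have hp : P i k = (1 - q ^ 2 * (q ^ i) ^ 2 / (q ^ k) ^ 2) *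
      (rowScale d a b c q i * invQFactorial q (i + 1) k) ∨ q ^ i = q ^ d ∧ q ^ k = 1 := by
    by_cases hik : i = d ∧ k = 0
    · exact Or.inr (by simp [hik])
    · left
      simp only [hP]
      rw [invQFactorial_eq_mul_succ hq fun hki => h2 _ (by omega) (by omega)]
      ring
  have hpm : (if i = 0 then 0 else P (i - 1) k) = -a⁻¹ * q ^ d / q ^ i *
      ((q ^ i)⁻¹ - a * b * c⁻¹ * (q ^ i / q ^ d / q)) * (1 - (q ^ i) ^ 2 / (q ^ k) ^ 2) * P i k := by
    rcases i with _ | n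
    · rcases k with _ | k
      · simp
      · simp [hP, invQFactorial]
    · have h0 := h.super_factor_ne_zero (i := n) (by omega)
      simp only [hP, Nat.add_sub_cancel, Nat.succ_ne_zero, if_false]
      rw [invQFactorial_eq_mul_succ hq fun hki => h2 _ (by omega) (by omega), rowScale_succ]
      generalize (q ^ (n + 1))⁻¹ - a * b * c⁻¹ * (q ^ (n + 1) / q ^ d / q) = w at h0 ⊢
      field_simp
      ring
  have hφ' : qφ d a b c q (i + 1) = a⁻¹ * b⁻¹ * (q ^ d * q) * (q ^ i * q - (q ^ i * q)⁻¹) *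
      (q ^ i / q ^ d - q ^ d / q ^ i) * ((q ^ i * q)⁻¹ - a * b * c * (q ^ i / q ^ d)) *
      ((q ^ i * q)⁻¹ - a * b * c⁻¹ * (q ^ i / q ^ d)) := by
    rw [qφ_eq_pow hq, pow_succ]
    field_simp
  have hφd : i = d → qφ d a b c q (i + 1) = 0 := by
    rintro rfl
    rw [hφ']
    simp
  obtain ⟨f, hf⟩ : ∃ f, f = -b⁻¹ * (q ^ i * q ^ 2) * (q ^ i * q - (q ^ i * q)⁻¹) *
      (q ^ i / q ^ d - q ^ d / q ^ i) * ((q ^ i * q)⁻¹ - a * b * c * (q ^ i / q ^ d)) *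
      (rowScale d a b c q i * invQFactorial q (i + 1) k) := ⟨_, rfl⟩
  have hf' : (if i = d then 0 else qφ d a b c q (i + 1) * P (i + 1) k) = f := by
    split_ifs with hid
    · rw [hf, hid]
      simp
    · have h0 := h.super_factor_ne_zero (i := i) (by omega)
      have e : (q ^ (i + 1))⁻¹ - a * b * c⁻¹ * (q ^ (i + 1) / q ^ d / q) =
          (q ^ i * q)⁻¹ - a * b * c⁻¹ * (q ^ i / q ^ d) := by
        rw [pow_succ]
        field_simp
      simp only [hP]
      rw [hf, hφ', rowScale_succ, e]
      rw [e] at h0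
      generalize (q ^ i * q)⁻¹ - a * b * c⁻¹ * (q ^ i / q ^ d) = w at h0 ⊢
      field_simp
      ring
  have hβ : (if k = 0 then 0 else P i (k - 1) * splitSuper d a b c q k) =
      splitSuper d a b c q k * (rowScale d a b c q i * invQFactorial q (i + 1) k) := by
    rcases k with _ | k
    · simp [splitSuper]
    · simp only [hP, invQFactorial_succ_succ, Nat.add_sub_cancel, Nat.succ_ne_zero, if_false]
      ring
  have hupper : (if i = d then 0 else qφ d a b c q (i + 1) *
      (qθ d a q (i + 1) * P (i + 1) k + if i + 1 = 0 then 0 else P (i + 1 - 1) k)) =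
      qθ d a q (i + 1) * f + qφ d a b c q (i + 1) * P i k := by
    rw [← hf', if_neg (Nat.succ_ne_zero i), Nat.add_sub_cancel]
    split_ifs with hid
    · rw [hφd hid]
      ring
    · ring
  have hlower : (if i = 0 then 0 else qθ d b q (i - 1) * P (i - 1) k +
      if i - 1 = d then 0 else qφ d a b c q (i - 1 + 1) * P (i - 1 + 1) k) =
      (b * (q ^ i / q) ^ 2 / q ^ d + b⁻¹ * q ^ d / (q ^ i / q) ^ 2) *
        (if i = 0 then 0 else P (i - 1) k) + qφ d a b c q i * P i k := by
    rcases i with _ | n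
    · simp [qφ]
    · rw [if_neg (by omega), if_neg (by omega), if_neg (by omega), Nat.add_sub_cancel,
        qθ_eq_pow hq, pow_succ q n, mul_div_cancel_right₀ _ hq]
  rw [hβ, hupper, hlower, hf', mul_comm (P i k)]
  exact matAe_triMat_entry_identity ha hb hc hq hx hy hD hq4 hq2 hp hpm hf (qφ_eq_pow hq ..) hφ'
    (qθ_eq_pow hq ..) (qθ_eq_pow hq ..) (by rw [qθ_eq_pow hq, pow_succ q i]) rfl (qθ_eq_pow hq ..) rfl

lemma QRACred.det_triMat_ne_zero {K : Type*} [Field K] {d : ℕ} {a b c q : K}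
    (h : QRACred d a b c q) : (triMat d a b c q).det ≠ 0 := by
  rw [Matrix.det_of_isLowerTriangular]
  · refine Finset.prod_ne_zero_iff.mpr fun i _ => ?_
    simpa [triMat, invQFactorial] using h.rowScale_ne_zero (Nat.lt_succ_iff.mp i.2)
  · intro i j hij
    have : (i : ℕ) < j := hij
    simp [triMat, invQFactorial_of_lt q this]

lemma QRACred.charpoly_matAe {K : Type*} [Field K] {d : ℕ} (hd : 3 ≤ d) {a b c q : K}
    (h : QRACred d a b c q) : (matAe d a b c q).charpoly =
      ∏ i : Fin (d + 1), (Polynomial.X - Polynomial.C (qθ d c q i)) := by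
  obtain ⟨u, hu⟩ : IsUnit (triMat d a b c q) :=
    (Matrix.isUnit_iff_isUnit_det _).mpr (isUnit_iff_ne_zero.mpr h.det_triMat_ne_zero)
  have hconj : matAe d a b c q = u.val * splitMat d a b c q * u.val⁻¹ := by
    rw [hu, ← h.matAe_mul_triMat hd, ← hu, ← Matrix.coe_units_inv, mul_assoc, Units.mul_inv,
      mul_one]
  rw [hconj, Matrix.charpoly_units_conj, Matrix.charpoly_of_isUpperTriangular]
  · simp [splitMat]
  · intro i j hij
    have : (j : ℕ) < i := hij
    simp only [splitMat, Matrix.of_apply]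
    grind

lemma multFree_iff_injective {K : Type*} [Field K] {n : ℕ} {X : Matrix (Fin n) (Fin n) K}
    {t : Fin n → K} (ht : X.charpoly = ∏ i : Fin n, (Polynomial.X - Polynomial.C (t i))) :
    MultFree X ↔ Function.Injective t := by
  refine ⟨fun ⟨e, he, hX⟩ => ?_, fun h => ⟨t, h, ht⟩⟩
  have hroots (f : Fin n → K) : (∏ i : Fin n, (Polynomial.X - Polynomial.C (f i))).roots =
      Finset.univ.val.map f := by
    rw [← Polynomial.roots_multiset_prod_X_sub_C (Finset.univ.val.map f), Multiset.map_map]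
    rfl
  have hmap : Finset.univ.val.map e = Finset.univ.val.map t := by
    rw [← hroots, ← hroots, ← hX, ht]
  have hnodup : (Finset.univ.val.map t).Nodup := hmap ▸ Finset.univ.nodup.map he
  intro i j hij
  exact Multiset.inj_on_of_nodup_map hnodup i (Finset.mem_univ i) j (Finset.mem_univ j) hij

lemma qθ_eq_iff {K : Type*} [Field K] {c q : K} (hc : c ≠ 0) (hq : q ≠ 0) {d i j : ℕ}
    (hij : (q ^ i) ^ 2 ≠ (q ^ j) ^ 2) :
    qθ d c q i = qθ d c q j ↔ c ^ 2 = q ^ (2 * (d : ℤ) - 2 * ((i + j : ℕ) : ℤ)) := by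
  have hx : q ^ i ≠ 0 := pow_ne_zero _ hq
  have hy : q ^ j ≠ 0 := pow_ne_zero _ hq
  have hD : q ^ d ≠ 0 := pow_ne_zero _ hq
  have e : q ^ (2 * (d : ℤ) - 2 * ((i + j : ℕ) : ℤ)) = (q ^ d) ^ 2 / (q ^ i * q ^ j) ^ 2 := by
    rw [zpow_sub₀ hq, mul_comm (2 : ℤ), mul_comm (2 : ℤ), zpow_mul, zpow_mul]
    norm_cast
    rw [pow_add]
  rw [e, qθ_eq_pow hq, qθ_eq_pow hq]
  generalize q ^ i = x at *
  generalize q ^ j = y at *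
  generalize q ^ d = D at *
  have hfac : c * x ^ 2 / D + c⁻¹ * D / x ^ 2 - (c * y ^ 2 / D + c⁻¹ * D / y ^ 2) =
      (x ^ 2 - y ^ 2) / (c * D) * (c ^ 2 - D ^ 2 / (x * y) ^ 2) := by
    field_simp
    ring
  rw [← sub_eq_zero, hfac, mul_eq_zero, sub_eq_zero (a := c ^ 2)]
  simp [sub_eq_zero, hij, hc, hD]

lemma sq_pow_ne_of_lt {K : Type*} [Field K] {q : K} (hq : q ≠ 0) {d : ℕ}
    (h : ∀ i : ℕ, 1 ≤ i → i ≤ d → q ^ (2 * i) ≠ 1) {i j : ℕ} (hij : i < j) (hj : j ≤ d) :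
    (q ^ i) ^ 2 ≠ (q ^ j) ^ 2 := by
  obtain ⟨m, rfl⟩ := Nat.exists_eq_add_of_lt hij
  intro he
  apply h (m + 1) (by omega) (by omega)
  have hx : (q ^ i) ^ 2 ≠ 0 := pow_ne_zero _ (pow_ne_zero _ hq)
  apply mul_left_cancel₀ hx
  rw [mul_one]
  nth_rewrite 2 [he]
  ring

lemma qθ_injective_iff {K : Type*} [Field K] {c q : K} (hc : c ≠ 0) (hq : q ≠ 0) {d : ℕ}
    (h : ∀ i : ℕ, 1 ≤ i → i ≤ d → q ^ (2 * i) ≠ 1) :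
    (Function.Injective fun i : Fin (d + 1) => qθ d c q (i : ℕ)) ↔
      ∀ i : ℕ, 1 ≤ i → i ≤ 2 * d - 1 → c ^ 2 ≠ q ^ (2 * (d : ℤ) - 2 * (i : ℤ)) := by
  constructor
  · intro hinj s hs1 hs2 heq
    obtain ⟨i, j, hij, hjd, rfl⟩ : ∃ i j : ℕ, i < j ∧ j ≤ d ∧ i + j = s := by
      by_cases hsd : s ≤ d
      · exact ⟨0, s, by omega, hsd, by omega⟩
      · exact ⟨s - d, d, by omega, le_rfl, by omega⟩
    have := (qθ_eq_iff hc hq (sq_pow_ne_of_lt hq h hij hjd)).mpr heq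
    have := @hinj ⟨i, by omega⟩ ⟨j, by omega⟩ this
    simp only [Fin.mk.injEq] at this
    omega
  · intro hne
    refine Function.Injective.of_lt_imp_ne fun i j hij heq => ?_
    have hij : (i : ℕ) < j := hij
    have hj : (j : ℕ) ≤ d := Nat.lt_succ_iff.mp j.2
    exact hne (i + j) (by omega) (by omega)
      ((qθ_eq_iff hc hq (sq_pow_ne_of_lt hq h hij hj)).mp heq)

/-- Corollary 12.9: A^ε is multiplicity-free iff the θ^ε_i are mutually distinct
iff c² is not among q^{2d−2}, q^{2d−4}, …, q^{2−2d}. -/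
theorem stmt_14 {K : Type*} [Field K] [IsAlgClosed K] (d : ℕ) (hd : 3 ≤ d)
    (a b c q : K) (h : QRACred d a b c q) :
    (MultFree (matAe d a b c q) ↔
      Function.Injective fun i : Fin (d + 1) => qθ d c q (i : ℕ)) ∧
    ((Function.Injective fun i : Fin (d + 1) => qθ d c q (i : ℕ)) ↔
      ∀ i : ℕ, 1 ≤ i → i ≤ 2 * d - 1 → c ^ 2 ≠ q ^ (2 * (d : ℤ) - 2 * (i : ℤ))) := by
  exact ⟨multFree_iff_injective (h.charpoly_matAe hd),
    qθ_injective_iff h.1.2.2.1 h.1.2.2.2 h.2.1⟩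
end

section
/- Set α = (b+b^{−1})(c+c^{−1}) + (a+a^{−1})(q^{d+1}+q^{−d−1}), α* = (c+c^{−1})(a+a^{−1}) + (b+b^{−1})(q^{d+1}+q^{−d−1}), α^ε = (a+a^{−1})(b+b^{−1}) + (c+c^{−1})(q^{d+1}+q^{−d−1}), and ψ = (q+q^{−1})² − (q^{d+1}+q^{−d−1})² − (a+a^{−1})² − (b+b^{−1})² − (c+c^{−1})² − (a+a^{−1})(b+b^{−1})(c+c^{−1})(q^{d+1}+q^{−d−1}). Then ψ·I is equal to each of the following six matrices: q·AA*A^ε + q²·A² + q^{−2}·(A*)² + q²·(A^ε)² − q·α·A − q^{−1}·α*·A* − q·α^ε·A^ε; q·A^εAA* + q²·(A^ε)² + q^{−2}·A² + q²·(A*)² − q·α^ε·A^ε − q^{−1}·α·A − q·α*·A*; q·A*A^εA + q²·(A*)² + q^{−2}·(A^ε)² + q²·A² − q·α*·A* − q^{−1}·α^ε·A^ε − q·α·A; q^{−1}·A*AA^ε + q^{−2}·(A*)² + q²·A² + q^{−2}·(A^ε)² − q^{−1}·α*·A* − q·α·A − q^{−1}·α^ε·A^ε; q^{−1}·A^εA*A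 + q^{−2}·(A^ε)² + q²·(A*)² + q^{−2}·A² − q^{−1}·α^ε·A^ε − q·α*·A* − q^{−1}·α·A; q^{−1}·AA^εA* + q^{−2}·A² + q²·(A^ε)² + q^{−2}·(A*)² − q^{−1}·α·A − q·α^ε·A^ε − q^{−1}·α*·A*. -/
/-- The set T-QRAC_red: conditions (T-RQRAC1)–(T-RQRAC4). -/
def TQRACred {K : Type*} [Field K] (d : ℕ) (a b c q : K) : Prop :=
  (a ≠ 0 ∧ b ≠ 0 ∧ c ≠ 0 ∧ q ≠ 0) ∧
  (∀ i : ℕ, 1 ≤ i → i ≤ d → q ^ (2 * i) ≠ 1) ∧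
  (∀ i : ℕ, 1 ≤ i → i ≤ 2 * d - 1 →
    a ^ 2 ≠ q ^ (2 * (d : ℤ) - 2 * (i : ℤ)) ∧
    b ^ 2 ≠ q ^ (2 * (d : ℤ) - 2 * (i : ℤ)) ∧
    c ^ 2 ≠ q ^ (2 * (d : ℤ) - 2 * (i : ℤ))) ∧
  (∀ i : ℕ, 1 ≤ i → i ≤ d →
    a * b * c ≠ q ^ ((d : ℤ) - 2 * (i : ℤ) + 1) ∧
    a⁻¹ * b * c ≠ q ^ ((d : ℤ) - 2 * (i : ℤ) + 1) ∧
    a * b⁻¹ * c ≠ q ^ ((d : ℤ) - 2 * (i : ℤ) + 1) ∧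
    a * b * c⁻¹ ≠ q ^ ((d : ℤ) - 2 * (i : ℤ) + 1))

section AskeyWilsonRelations

variable {K : Type*} [Field K]

/-- Three elements of an algebra that satisfy the ℤ₃-symmetric Askey-Wilson relations and one of
the six expressions for the Casimir element satisfy all the other ones. -/
theorem casimir_of_askeyWilson {R : Type*} [Ring R] [Algebra K R] {A B C : R} {q p α β γ ψ : K}
    (hA : q • (B * C) - p • (C * B) = ((q - p) * α) • (1 : R) - (q ^ 2 - p ^ 2) • A)
    (hB : q • (C * A) - p • (A * C) = ((q - p) * β) • (1 : R) - (q ^ 2 - p ^ 2) • B)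
    (hC : q • (A * B) - p • (B * A) = ((q - p) * γ) • (1 : R) - (q ^ 2 - p ^ 2) • C)
    (hψ : ψ • (1 : R) = q • (A * B * C) + q ^ 2 • A ^ 2 + p ^ 2 • B ^ 2 + q ^ 2 • C ^ 2 -
      (q * α) • A - (p * β) • B - (q * γ) • C) :
    (ψ • (1 : R) = q • (A * B * C) + q ^ 2 • A ^ 2 + p ^ 2 • B ^ 2 + q ^ 2 • C ^ 2 -
      (q * α) • A - (p * β) • B - (q * γ) • C) ∧
    (ψ • (1 : R) = q • (C * A * B) + q ^ 2 • C ^ 2 + p ^ 2 • A ^ 2 + q ^ 2 • B ^ 2 -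
      (q * γ) • C - (p * α) • A - (q * β) • B) ∧
    (ψ • (1 : R) = q • (B * C * A) + q ^ 2 • B ^ 2 + p ^ 2 • C ^ 2 + q ^ 2 • A ^ 2 -
      (q * β) • B - (p * γ) • C - (q * α) • A) ∧
    (ψ • (1 : R) = p • (B * A * C) + p ^ 2 • B ^ 2 + q ^ 2 • A ^ 2 + p ^ 2 • C ^ 2 -
      (p * β) • B - (q * α) • A - (p * γ) • C) ∧
    (ψ • (1 : R) = p • (C * B * A) + p ^ 2 • C ^ 2 + q ^ 2 • B ^ 2 + p ^ 2 • A ^ 2 -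
      (p * γ) • C - (q * β) • B - (p * α) • A) ∧
    (ψ • (1 : R) = p • (A * C * B) + p ^ 2 • A ^ 2 + q ^ 2 • C ^ 2 + p ^ 2 • B ^ 2 -
      (p * α) • A - (q * γ) • C - (p * β) • B) := by
  have hCC := congrArg (· * C) hC
  have hAA := congrArg (A * ·) hA
  have hBB := congrArg (· * B) hB
  have hCC' := congrArg (C * ·) hC
  have hBB' := congrArg (B * ·) hB
  simp only [sub_mul, mul_sub, smul_mul_assoc, mul_smul_comm, one_mul, mul_one, ← mul_assoc,
    ← pow_two] at hCC hAA hBB hCC' hBB'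
  have h₄ : ψ • (1 : R) = p • (B * A * C) + p ^ 2 • B ^ 2 + q ^ 2 • A ^ 2 + p ^ 2 • C ^ 2 -
      (p * β) • B - (q * α) • A - (p * γ) • C := by
    linear_combination (norm := module) hψ + hCC
  have h₆ : ψ • (1 : R) = p • (A * C * B) + p ^ 2 • A ^ 2 + q ^ 2 • C ^ 2 + p ^ 2 • B ^ 2 -
      (p * α) • A - (q * γ) • C - (p * β) • B := by
    linear_combination (norm := module) hψ + hAA
  have h₂ : ψ • (1 : R) = q • (C * A * B) + q ^ 2 • C ^ 2 + p ^ 2 • A ^ 2 + q ^ 2 • B ^ 2 -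
      (q * γ) • C - (p * α) • A - (q * β) • B := by
    linear_combination (norm := module) h₆ - hBB
  refine ⟨hψ, h₂, ?_, h₄, ?_, h₆⟩
  · linear_combination (norm := module) h₄ - hBB'
  · linear_combination (norm := module) h₂ + hCC'

/-- The operator on sequences indexed by `ℤ` given by the tridiagonal `ℤ × ℤ` matrix with
subdiagonal `l`, diagonal `m` and superdiagonal `u`. -/
def tridiagonal (l m u : ℤ → K) : Module.End K (ℤ → K) where
  toFun w i := l i * w (i - 1) + m i * w i + u i * w (i + 1)
  map_add' v w := by ext i; simp only [Pi.add_apply]; ring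
  map_smul' r w := by ext i; simp only [Pi.smul_apply, smul_eq_mul, RingHom.id_apply]; ring

theorem tridiagonal_apply (l m u w : ℤ → K) (i : ℤ) :
    tridiagonal l m u w i = l i * w (i - 1) + m i * w i + u i * w (i + 1) := rfl

/-- The pairs of a finite matrix and an operator on `ℤ`-indexed sequences such that the operator
preserves the sequences vanishing at negative indices, and acts on the coordinates `0, …, d` of
these as the matrix. -/
def compressionSubalgebra (K : Type*) [Field K] (d : ℕ) :
    Subalgebra K (Matrix (Fin (d + 1)) (Fin (d + 1)) K × Module.End K (ℤ → K)) where
  carrier := {x | ∀ w : ℤ → K, (∀ i < 0, w i = 0) → (∀ i < 0, x.2 w i = 0) ∧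
    ∀ i : Fin (d + 1), x.2 w i = x.1.mulVec (fun j : Fin (d + 1) => w j) i}
  mul_mem' {x y} hx hy w hw := by
    obtain ⟨hy₁, hy₂⟩ := hy w hw
    obtain ⟨hx₁, hx₂⟩ := hx _ hy₁
    refine ⟨hx₁, fun i => ?_⟩
    simp only [Prod.fst_mul, Prod.snd_mul, Module.End.mul_apply, hx₂, ← Matrix.mulVec_mulVec]
    congr 2
    exact funext hy₂
  add_mem' {x y} hx hy w hw := by
    obtain ⟨hx₁, hx₂⟩ := hx w hw
    obtain ⟨hy₁, hy₂⟩ := hy w hw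
    refine ⟨fun i hi => ?_, fun i => ?_⟩
    · simp [hx₁ i hi, hy₁ i hi]
    · simp [hx₂, hy₂, Matrix.add_mulVec]
  algebraMap_mem' r w hw := by
    refine ⟨fun i hi => ?_, fun i => ?_⟩
    · simp [Algebra.algebraMap_eq_smul_one, hw i hi]
    · simp [Algebra.algebraMap_eq_smul_one, Matrix.smul_mulVec]

theorem fst_eq_zero_of_mem_compressionSubalgebra {d : ℕ}
    {x : Matrix (Fin (d + 1)) (Fin (d + 1)) K × Module.End K (ℤ → K)}
    (hx : x ∈ compressionSubalgebra K d) (h : x.2 = 0) : x.1 = 0 := by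
  refine Matrix.ext_of_mulVec_single fun j => funext fun i => ?_
  have hj := (hx (Pi.single (j : ℤ) 1) fun i hi => Pi.single_eq_of_ne (by omega) _).2 i
  have hw : (fun k : Fin (d + 1) => (Pi.single (j : ℤ) 1 : ℤ → K) k) = Pi.single j 1 := by
    ext k
    simp [Pi.single_apply, Fin.ext_iff]
  rw [hw, h] at hj
  simpa using hj.symm

/-- A tridiagonal operator whose matrix is block triangular compresses to the corresponding
finite tridiagonal matrix. -/
theorem mem_compressionSubalgebra_of_tridiagonal {d : ℕ}
    {M : Matrix (Fin (d + 1)) (Fin (d + 1)) K} {l m u : ℤ → K}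
    (h₀ : u (-1) = 0) (hd : u d = 0)
    (hM : ∀ i j : Fin (d + 1), M i j = if (i : ℕ) = j then m i else if (i : ℕ) = j + 1 then l i
      else if (j : ℕ) = i + 1 then u i else 0) :
    (M, tridiagonal l m u) ∈ compressionSubalgebra K d := by
  intro w hw
  refine ⟨fun i hi => ?_, fun i => ?_⟩
  · rw [tridiagonal_apply, hw i hi, hw (i - 1) (by omega)]
    rcases eq_or_ne i (-1) with rfl | hi'
    · simp [h₀]
    · simp [hw (i + 1) (by omega)]
  · have hterm : ∀ j : Fin (d + 1), M i j * w j =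
        (if (j : ℕ) + 1 = i then l i * w (i - 1) else 0) + (if j = i then m i * w i else 0) +
          (if (j : ℕ) = i + 1 then u i * w (i + 1) else 0) := by
      intro j
      rw [hM]
      rcases lt_trichotomy (j : ℕ) i with h | h | h
      · by_cases h1 : (j : ℕ) + 1 = i
        · have : ((i : ℕ) : ℤ) - 1 = (j : ℕ) := by omega
          simp [h1, this, h.ne', Fin.ext_iff, h.ne, show ¬ (j : ℕ) = i + 1 by omega]
        · simp [h1, Ne.symm h1, h.ne', Fin.ext_iff, h.ne, show ¬ (j : ℕ) = i + 1 by omega]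
      · simp [h, Fin.ext_iff]
      · by_cases h1 : (j : ℕ) = i + 1
        · simp [h1, Fin.ext_iff, show ¬ (i : ℕ) + 1 + 1 = i by omega,
            show ¬ (i : ℕ) = i + 1 + 1 by omega]
        · simp [h1, h.ne', Fin.ext_iff, h.ne, show ¬ (j : ℕ) + 1 = i by omega,
            show ¬ (i : ℕ) = j + 1 by omega]
    simp only [Matrix.mulVec, dotProduct, hterm, Finset.sum_add_distrib, tridiagonal_apply]
    congr 1
    · congr 1
      · rcases Nat.eq_zero_or_pos (i : ℕ) with h | h
        · simp [h, hw]
        · rw [Finset.sum_eq_single (⟨i - 1, by omega⟩ : Fin (d + 1))]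
          · simp [Nat.sub_add_cancel h]
          · intro j _ hj
            refine if_neg fun h' => hj (Fin.ext ?_)
            simp only
            omega
          · simp
      · simp
    · rcases (Nat.lt_succ_iff.mp i.2).lt_or_eq with h | h
      · rw [Finset.sum_eq_single (⟨i + 1, by omega⟩ : Fin (d + 1))]
        · simp
        · intro j _ hj
          exact if_neg fun h' => hj (Fin.ext h')
        · simp
      · simp [h, hd]

/-- The operator extending `matA` when `ζ i = q ^ (2 * i - d)`. -/
noncomputable def opA (a : K) (ζ : ℤ → K) : Module.End K (ℤ → K) :=
  tridiagonal 1 (fun i => a * ζ i + a⁻¹ * (ζ i)⁻¹) 0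

/-- The factored form of the first split sequence `φ_i`, as a function of `z = q ^ (2 * i - d - 1)`
with `s = c + c⁻¹` and `e = q ^ (d + 1) + q ^ (-d - 1)`. -/
noncomputable def splitPhi (a b s e z : K) : K :=
  (z + z⁻¹ - e) * (a * b * z + (a * b * z)⁻¹ - s)

/-- The operator extending `matAs` when `ζ i = q ^ (2 * i - d)`. -/
noncomputable def opAs (a b s e q : K) (ζ : ℤ → K) : Module.End K (ℤ → K) :=
  tridiagonal 0 (fun i => b * ζ i + b⁻¹ * (ζ i)⁻¹) (fun i => splitPhi a b s e (ζ i * q))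

/-- The operator extending `matAe` when `ζ i = q ^ (2 * i - d)`. -/
noncomputable def opAe (a b s e q : K) (ζ : ℤ → K) : Module.End K (ℤ → K) :=
  tridiagonal (fun i => -b⁻¹ * q * (ζ i)⁻¹)
    (fun i => -(q + q⁻¹) * (a * b * ζ i ^ 2)⁻¹ + ((a * b)⁻¹ * e + s) * (ζ i)⁻¹)
    (fun i => -a⁻¹ * (ζ i * q)⁻¹ * splitPhi a b s e (ζ i * q))

section Operators

variable {a b s e q : K} {ζ : ℤ → K}

theorem opAe_relation (ha : a ≠ 0) (hb : b ≠ 0) (hq : q ≠ 0) (hζ : ∀ i, ζ i ≠ 0)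
    (hs : ∀ i, ζ (i + 1) = ζ i * q ^ 2) (hp : ∀ i, ζ (i - 1) = ζ i * (q ^ 2)⁻¹) :
    q • (opA a ζ * opAs a b s e q ζ) - q⁻¹ • (opAs a b s e q ζ * opA a ζ) =
      ((q - q⁻¹) * ((a + a⁻¹) * (b + b⁻¹) + s * e)) • (1 : Module.End K (ℤ → K)) -
        (q ^ 2 - q⁻¹ ^ 2) • opAe a b s e q ζ := by
  refine LinearMap.ext fun w => funext fun i => ?_
  have h := hζ i
  simp only [opA, opAs, opAe, splitPhi, LinearMap.sub_apply, LinearMap.smul_apply,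
    Module.End.mul_apply, Module.End.one_apply, Pi.sub_apply, Pi.smul_apply, smul_eq_mul,
    tridiagonal_apply, hs, hp, Pi.one_apply, Pi.zero_apply, sub_add_cancel, add_sub_cancel_right]
  field_simp
  ring

theorem opA_relation (ha : a ≠ 0) (hb : b ≠ 0) (hq : q ≠ 0) (hζ : ∀ i, ζ i ≠ 0)
    (hs : ∀ i, ζ (i + 1) = ζ i * q ^ 2) (hp : ∀ i, ζ (i - 1) = ζ i * (q ^ 2)⁻¹) :
    q • (opAs a b s e q ζ * opAe a b s e q ζ) - q⁻¹ • (opAe a b s e q ζ * opAs a b s e q ζ) =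
      ((q - q⁻¹) * ((b + b⁻¹) * s + (a + a⁻¹) * e)) • (1 : Module.End K (ℤ → K)) -
        (q ^ 2 - q⁻¹ ^ 2) • opA a ζ := by
  refine LinearMap.ext fun w => funext fun i => ?_
  have h := hζ i
  simp only [opA, opAs, opAe, splitPhi, LinearMap.sub_apply, LinearMap.smul_apply,
    Module.End.mul_apply, Module.End.one_apply, Pi.sub_apply, Pi.smul_apply, smul_eq_mul,
    tridiagonal_apply, hs, hp, Pi.one_apply, Pi.zero_apply, sub_add_cancel, add_sub_cancel_right]
  field_simp
  ring

theorem opAs_relation (ha : a ≠ 0) (hb : b ≠ 0) (hq : q ≠ 0) (hζ : ∀ i, ζ i ≠ 0)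
    (hs : ∀ i, ζ (i + 1) = ζ i * q ^ 2) (hp : ∀ i, ζ (i - 1) = ζ i * (q ^ 2)⁻¹) :
    q • (opAe a b s e q ζ * opA a ζ) - q⁻¹ • (opA a ζ * opAe a b s e q ζ) =
      ((q - q⁻¹) * (s * (a + a⁻¹) + (b + b⁻¹) * e)) • (1 : Module.End K (ℤ → K)) -
        (q ^ 2 - q⁻¹ ^ 2) • opAs a b s e q ζ := by
  refine LinearMap.ext fun w => funext fun i => ?_
  have h := hζ i
  simp only [opA, opAs, opAe, splitPhi, LinearMap.sub_apply, LinearMap.smul_apply,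
    Module.End.mul_apply, Module.End.one_apply, Pi.sub_apply, Pi.smul_apply, smul_eq_mul,
    tridiagonal_apply, hs, hp, Pi.one_apply, Pi.zero_apply, sub_add_cancel, add_sub_cancel_right]
  field_simp
  ring

theorem op_casimir (ha : a ≠ 0) (hb : b ≠ 0) (hq : q ≠ 0) (hζ : ∀ i, ζ i ≠ 0)
    (hs : ∀ i, ζ (i + 1) = ζ i * q ^ 2) (hp : ∀ i, ζ (i - 1) = ζ i * (q ^ 2)⁻¹) :
    ((q + q⁻¹) ^ 2 - e ^ 2 - (a + a⁻¹) ^ 2 - (b + b⁻¹) ^ 2 - s ^ 2 -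
        (a + a⁻¹) * (b + b⁻¹) * s * e) • (1 : Module.End K (ℤ → K)) =
      q • (opA a ζ * opAs a b s e q ζ * opAe a b s e q ζ) + q ^ 2 • opA a ζ ^ 2 +
        q⁻¹ ^ 2 • opAs a b s e q ζ ^ 2 + q ^ 2 • opAe a b s e q ζ ^ 2 -
        (q * ((b + b⁻¹) * s + (a + a⁻¹) * e)) • opA a ζ -
        (q⁻¹ * (s * (a + a⁻¹) + (b + b⁻¹) * e)) • opAs a b s e q ζ -
        (q * ((a + a⁻¹) * (b + b⁻¹) + s * e)) • opAe a b s e q ζ := by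
  refine LinearMap.ext fun w => funext fun i => ?_
  have h := hζ i
  simp only [pow_two (opA _ _), pow_two (opAs _ _ _ _ _ _), pow_two (opAe _ _ _ _ _ _)]
  simp only [opA, opAs, opAe, splitPhi, LinearMap.sub_apply, LinearMap.add_apply,
    LinearMap.smul_apply, Pi.add_apply,
    Module.End.mul_apply, Module.End.one_apply, Pi.sub_apply, Pi.smul_apply, smul_eq_mul,
    tridiagonal_apply, hs, hp, Pi.one_apply, Pi.zero_apply, sub_add_cancel, add_sub_cancel_right]
  field_simp
  ring

end Operators

section Compression

variable {d : ℕ} {a b c q : K}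

theorem matA_mem_compressionSubalgebra (d : ℕ) (a q : K) :
    (matA d a q, opA a fun i => q ^ (2 * i - d)) ∈ compressionSubalgebra K d := by
  refine mem_compressionSubalgebra_of_tridiagonal rfl rfl fun i j => ?_
  have h : q ^ ((d : ℤ) - 2 * (i : ℕ)) = (q ^ (2 * ((i : ℕ) : ℤ) - d))⁻¹ := by
    rw [← zpow_neg, neg_sub]
  simp only [matA, Matrix.of_apply, qθ, Pi.one_apply, Pi.zero_apply, ite_self, h]

theorem qφ_eq_splitPhi (ha : a ≠ 0) (hb : b ≠ 0) (hc : c ≠ 0) (hq : q ≠ 0) (i : ℕ) :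
    qφ d a b c q (i + 1) = splitPhi a b (c + c⁻¹) (q ^ ((d : ℤ) + 1) + q ^ (-(d : ℤ) - 1))
      (q ^ (2 * (i : ℤ) - d) * q) := by
  have h₁ : q ^ ((d : ℤ) + 1) = q ^ d * q := by rw [zpow_add_one₀ hq, zpow_natCast]
  have h₂ : q ^ (-(d : ℤ) - 1) = (q ^ d * q)⁻¹ := by rw [← h₁, ← zpow_neg]; congr 1; ring
  have h₃ : q ^ (((i + 1 : ℕ) : ℤ)) = q ^ i * q := by rw [zpow_natCast, pow_succ]
  have h₄ : q ^ (((i + 1 : ℕ) : ℤ) - d - 1) = q ^ i * (q ^ d)⁻¹ := by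
    rw [← zpow_natCast, ← zpow_natCast, ← zpow_neg, ← zpow_add₀ hq]; congr 1; push_cast; ring
  have h₅ : q ^ ((d : ℤ) - ((i + 1 : ℕ) : ℤ) + 1) = q ^ d * (q ^ i)⁻¹ := by
    rw [← zpow_natCast, ← zpow_natCast, ← zpow_neg, ← zpow_add₀ hq]; congr 1; push_cast; ring
  have h₆ : q ^ (2 * (i : ℤ) - d) = (q ^ i) ^ 2 * (q ^ d)⁻¹ := by
    rw [zpow_sub₀ hq, zpow_natCast, mul_comm 2, zpow_mul, zpow_natCast, div_eq_mul_inv]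
    norm_cast
  have hi := pow_ne_zero i hq
  have hd := pow_ne_zero d hq
  rw [qφ, splitPhi, zpow_neg, h₁, h₂, h₃, h₄, h₅, h₆]
  generalize q ^ i = x at *
  generalize q ^ d = y at *
  field_simp
  ring

theorem matAs_mem_compressionSubalgebra (ha : a ≠ 0) (hb : b ≠ 0) (hc : c ≠ 0) (hq : q ≠ 0) :
    (matAs d a b c q, opAs a b (c + c⁻¹) (q ^ ((d : ℤ) + 1) + q ^ (-(d : ℤ) - 1)) q
      fun i => q ^ (2 * i - d)) ∈ compressionSubalgebra K d := by
  refine mem_compressionSubalgebra_of_tridiagonal ?_ ?_ fun i j => ?_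
  · have h : q ^ (2 * (-1 : ℤ) - d) * q = q ^ (-(d : ℤ) - 1) := by
      rw [← zpow_add_one₀ hq]; congr 1; ring
    have h' : (q ^ (-(d : ℤ) - 1))⁻¹ = q ^ ((d : ℤ) + 1) := by
      rw [← zpow_neg]; congr 1; ring
    simp only [splitPhi, h, h']
    ring
  · have h : q ^ (2 * (d : ℤ) - d) * q = q ^ ((d : ℤ) + 1) := by
      rw [← zpow_add_one₀ hq]; congr 1; ring
    have h' : (q ^ ((d : ℤ) + 1))⁻¹ = q ^ (-(d : ℤ) - 1) := by
      rw [← zpow_neg]; congr 1; ring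
    simp only [splitPhi, h, h']
    ring
  · have h : q ^ ((d : ℤ) - 2 * (i : ℕ)) = (q ^ (2 * ((i : ℕ) : ℤ) - d))⁻¹ := by
      rw [← zpow_neg, neg_sub]
    simp only [matAs, Matrix.of_apply, qθ, Pi.zero_apply, h, ← qφ_eq_splitPhi ha hb hc hq]
    split_ifs <;> first | rfl | omega | simp_all

end Compression

end AskeyWilsonRelations

/-- Proposition 18.1: the six ℤ₃-symmetric cubic relations, each equal to ψ·I. -/
theorem stmt_16 {K : Type*} [Field K] [IsAlgClosed K] (d : ℕ) (hd : 3 ≤ d)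
    (a b c q : K) (h : TQRACred d a b c q)
    (α αs αε ψ : K)
    (hα : α = (b + b⁻¹) * (c + c⁻¹) + (a + a⁻¹) * (q ^ ((d : ℤ) + 1) + q ^ (-(d : ℤ) - 1)))
    (hαs : αs = (c + c⁻¹) * (a + a⁻¹) + (b + b⁻¹) * (q ^ ((d : ℤ) + 1) + q ^ (-(d : ℤ) - 1)))
    (hαε : αε = (a + a⁻¹) * (b + b⁻¹) + (c + c⁻¹) * (q ^ ((d : ℤ) + 1) + q ^ (-(d : ℤ) - 1)))
    (hψ : ψ = (q + q⁻¹) ^ 2 - (q ^ ((d : ℤ) + 1) + q ^ (-(d : ℤ) - 1)) ^ 2 -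
      (a + a⁻¹) ^ 2 - (b + b⁻¹) ^ 2 - (c + c⁻¹) ^ 2 -
      (a + a⁻¹) * (b + b⁻¹) * (c + c⁻¹) * (q ^ ((d : ℤ) + 1) + q ^ (-(d : ℤ) - 1))) :
    (ψ • (1 : Matrix (Fin (d + 1)) (Fin (d + 1)) K) =
      q • (matA d a q * matAs d a b c q * matAe d a b c q) +
        (q ^ 2) • matA d a q ^ 2 + (q ^ (-2 : ℤ)) • matAs d a b c q ^ 2 +
        (q ^ 2) • matAe d a b c q ^ 2 -
        (q * α) • matA d a q - (q⁻¹ * αs) • matAs d a b c q - (q * αε) • matAe d a b c q) ∧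
    (ψ • (1 : Matrix (Fin (d + 1)) (Fin (d + 1)) K) =
      q • (matAe d a b c q * matA d a q * matAs d a b c q) +
        (q ^ 2) • matAe d a b c q ^ 2 + (q ^ (-2 : ℤ)) • matA d a q ^ 2 +
        (q ^ 2) • matAs d a b c q ^ 2 -
        (q * αε) • matAe d a b c q - (q⁻¹ * α) • matA d a q - (q * αs) • matAs d a b c q) ∧
    (ψ • (1 : Matrix (Fin (d + 1)) (Fin (d + 1)) K) =
      q • (matAs d a b c q * matAe d a b c q * matA d a q) +
        (q ^ 2) • matAs d a b c q ^ 2 + (q ^ (-2 : ℤ)) • matAe d a b c q ^ 2 +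
        (q ^ 2) • matA d a q ^ 2 -
        (q * αs) • matAs d a b c q - (q⁻¹ * αε) • matAe d a b c q - (q * α) • matA d a q) ∧
    (ψ • (1 : Matrix (Fin (d + 1)) (Fin (d + 1)) K) =
      q⁻¹ • (matAs d a b c q * matA d a q * matAe d a b c q) +
        (q ^ (-2 : ℤ)) • matAs d a b c q ^ 2 + (q ^ 2) • matA d a q ^ 2 +
        (q ^ (-2 : ℤ)) • matAe d a b c q ^ 2 -
        (q⁻¹ * αs) • matAs d a b c q - (q * α) • matA d a q - (q⁻¹ * αε) • matAe d a b c q) ∧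
    (ψ • (1 : Matrix (Fin (d + 1)) (Fin (d + 1)) K) =
      q⁻¹ • (matAe d a b c q * matAs d a b c q * matA d a q) +
        (q ^ (-2 : ℤ)) • matAe d a b c q ^ 2 + (q ^ 2) • matAs d a b c q ^ 2 +
        (q ^ (-2 : ℤ)) • matA d a q ^ 2 -
        (q⁻¹ * αε) • matAe d a b c q - (q * αs) • matAs d a b c q - (q⁻¹ * α) • matA d a q) ∧
    (ψ • (1 : Matrix (Fin (d + 1)) (Fin (d + 1)) K) =
      q⁻¹ • (matA d a q * matAe d a b c q * matAs d a b c q) +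
        (q ^ (-2 : ℤ)) • matA d a q ^ 2 + (q ^ 2) • matAe d a b c q ^ 2 +
        (q ^ (-2 : ℤ)) • matAs d a b c q ^ 2 -
        (q⁻¹ * α) • matA d a q - (q * αε) • matAe d a b c q - (q⁻¹ * αs) • matAs d a b c q) := by
  obtain ⟨⟨ha, hb, hc, hq⟩, hpow, -, -⟩ := h
  have hq₄ : q ^ 4 ≠ 1 := hpow 2 one_le_two (by omega)
  have hinv : q ^ (-2 : ℤ) = q⁻¹ ^ 2 := by rw [zpow_neg, inv_pow, zpow_ofNat]
  have hsub : q ^ 2 - q⁻¹ ^ 2 ≠ 0 := fun h0 => hq₄ <| by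
    field_simp at h0
    linear_combination h0
  have hadd : q + q⁻¹ ≠ 0 := fun h0 => hsub <| by linear_combination (q - q⁻¹) * h0
  have hC : q • (matA d a q * matAs d a b c q) - q⁻¹ • (matAs d a b c q * matA d a q) =
      ((q - q⁻¹) * αε) • (1 : Matrix (Fin (d + 1)) (Fin (d + 1)) K) -
        (q ^ 2 - q⁻¹ ^ 2) • matAe d a b c q := by
    have hcoef : (q ^ 2 - q⁻¹ ^ 2) * (αε / (q + q⁻¹)) = (q - q⁻¹) * αε := by
      rw [← mul_div_assoc, div_eq_iff hadd]
      ring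
    rw [matAe, ← hαε, hinv, smul_add, smul_smul, smul_smul, mul_inv_cancel₀ hsub, hcoef]
    module
  have hζ : ∀ i : ℤ, q ^ (2 * i - d) ≠ 0 := fun i => zpow_ne_zero _ hq
  have hs : ∀ i : ℤ, q ^ (2 * (i + 1) - d) = q ^ (2 * i - d) * q ^ 2 := fun i => by
    rw [← zpow_natCast, ← zpow_add₀ hq]; congr 1; push_cast; ring
  have hp : ∀ i : ℤ, q ^ (2 * (i - 1) - d) = q ^ (2 * i - d) * (q ^ 2)⁻¹ := fun i => by
    rw [← zpow_natCast, ← zpow_neg, ← zpow_add₀ hq]; congr 1; push_cast; ring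
  set e := q ^ ((d : ℤ) + 1) + q ^ (-(d : ℤ) - 1)
  set ζ : ℤ → K := fun i => q ^ (2 * i - d)
  have hopA := opA_relation (s := c + c⁻¹) (e := e) (ζ := ζ) ha hb hq hζ hs hp
  have hopAs := opAs_relation (s := c + c⁻¹) (e := e) (ζ := ζ) ha hb hq hζ hs hp
  have hopAe := opAe_relation (s := c + c⁻¹) (e := e) (ζ := ζ) ha hb hq hζ hs hp
  have hop := op_casimir (s := c + c⁻¹) (e := e) (ζ := ζ) ha hb hq hζ hs hp
  rw [← hα] at hopA
  rw [← hαs] at hopAs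
  rw [← hαε] at hopAe
  rw [← hα, ← hαs, ← hαε, ← hψ] at hop
  let S := compressionSubalgebra K d
  have hA_mem : (matA d a q, opA a ζ) ∈ S := matA_mem_compressionSubalgebra d a q
  have hAs_mem : (matAs d a b c q, opAs a b (c + c⁻¹) e q ζ) ∈ S :=
    matAs_mem_compressionSubalgebra ha hb hc hq
  have hAe_mem : (matAe d a b c q, opAe a b (c + c⁻¹) e q ζ) ∈ S := by
    have h := S.smul_mem (S.sub_mem (S.smul_mem S.one_mem ((q - q⁻¹) * αε))
      (S.sub_mem (S.smul_mem (S.mul_mem hA_mem hAs_mem) q)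
        (S.smul_mem (S.mul_mem hAs_mem hA_mem) q⁻¹))) (q ^ 2 - q⁻¹ ^ 2)⁻¹
    convert h using 1
    refine Prod.ext ?_ ?_
    · simp only [Prod.smul_fst, Prod.fst_sub, Prod.fst_mul, Prod.fst_one, hC, sub_sub_cancel,
        inv_smul_smul₀ hsub]
    · simp only [Prod.smul_snd, Prod.snd_sub, Prod.snd_mul, Prod.snd_one, hopAe, sub_sub_cancel,
        inv_smul_smul₀ hsub]
  rw [hinv]
  refine casimir_of_askeyWilson ?_ ?_ hC ?_
  · have h := S.sub_mem (S.sub_mem (S.smul_mem (S.mul_mem hAs_mem hAe_mem) q)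
      (S.smul_mem (S.mul_mem hAe_mem hAs_mem) q⁻¹))
      (S.sub_mem (S.smul_mem S.one_mem ((q - q⁻¹) * α)) (S.smul_mem hA_mem (q ^ 2 - q⁻¹ ^ 2)))
    exact sub_eq_zero.mp (fst_eq_zero_of_mem_compressionSubalgebra h (sub_eq_zero.mpr hopA))
  · have h := S.sub_mem (S.sub_mem (S.smul_mem (S.mul_mem hAe_mem hA_mem) q)
      (S.smul_mem (S.mul_mem hA_mem hAe_mem) q⁻¹))
      (S.sub_mem (S.smul_mem S.one_mem ((q - q⁻¹) * αs)) (S.smul_mem hAs_mem (q ^ 2 - q⁻¹ ^ 2)))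
    exact sub_eq_zero.mp (fst_eq_zero_of_mem_compressionSubalgebra h (sub_eq_zero.mpr hopAs))
  · have h := S.sub_mem (S.smul_mem S.one_mem ψ) (S.sub_mem (S.sub_mem (S.sub_mem
      (S.add_mem (S.add_mem (S.add_mem
        (S.smul_mem (S.mul_mem (S.mul_mem hA_mem hAs_mem) hAe_mem) q)
        (S.smul_mem (S.pow_mem hA_mem 2) (q ^ 2))) (S.smul_mem (S.pow_mem hAs_mem 2) (q⁻¹ ^ 2)))
        (S.smul_mem (S.pow_mem hAe_mem 2) (q ^ 2)))
      (S.smul_mem hA_mem (q * α))) (S.smul_mem hAs_mem (q⁻¹ * αs)))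
      (S.smul_mem hAe_mem (q * αε)))
    exact sub_eq_zero.mp (fst_eq_zero_of_mem_compressionSubalgebra h (sub_eq_zero.mpr hop))
end

section
/- Let (a,b,c;q) ∈ T-QRAC_red. Call (x,y,z;t) ∈ T-QRAC_red a twin of (a,b,c;q) whenever for all 0 ≤ i ≤ d: x·t^{2i−d} + x^{−1}·t^{d−2i} = a·q^{2i−d} + a^{−1}·q^{d−2i}, y·t^{2i−d} + y^{−1}·t^{d−2i} = b·q^{2i−d} + b^{−1}·q^{d−2i}, and z·t^{2i−d} + z^{−1}·t^{d−2i} = c·q^{2i−d} + c^{−1}·q^{d−2i}. Then: (i) if none of abc, a^{−1}bc, ab^{−1}c, abc^{−1} equals −q^{d−2i+1} for any 1 ≤ i ≤ d, the twins of (a,b,c;q) are exactly the tuples (a,b,c;q), (a^{−1},b^{−1},c^{−1};q^{−1}), ((−1)^d a, (−1)^d b, (−1)^d c; −q), and ((−1)^d a^{−1}, (−1)^d b^{−1}, (−1)^d c^{−1}; −q^{−1}); (ii) if some of abc, a^{−1}bc, ab^{−1}c, abc^{−1} equals −q^{d−2i+1} for some 1 ≤ i ≤ d, the twins of (a,b,c;q)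 are exactly (a,b,c;q) and (a^{−1},b^{−1},c^{−1};q^{−1}). -/
/-- (x,y,z;t) ∈ T-QRAC_red is a twin of (a,b,c;q): same three eigenvalue sequences. -/
def IsTwin {K : Type*} [Field K] (d : ℕ) (a b c q x y z t : K) : Prop :=
  TQRACred d x y z t ∧
  ∀ i : ℕ, i ≤ d →
    x * t ^ (2 * (i : ℤ) - (d : ℤ)) + x⁻¹ * t ^ ((d : ℤ) - 2 * (i : ℤ)) =
      a * q ^ (2 * (i : ℤ) - (d : ℤ)) + a⁻¹ * q ^ ((d : ℤ) - 2 * (i : ℤ)) ∧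
    y * t ^ (2 * (i : ℤ) - (d : ℤ)) + y⁻¹ * t ^ ((d : ℤ) - 2 * (i : ℤ)) =
      b * q ^ (2 * (i : ℤ) - (d : ℤ)) + b⁻¹ * q ^ ((d : ℤ) - 2 * (i : ℤ)) ∧
    z * t ^ (2 * (i : ℤ) - (d : ℤ)) + z⁻¹ * t ^ ((d : ℤ) - 2 * (i : ℤ)) =
      c * q ^ (2 * (i : ℤ) - (d : ℤ)) + c⁻¹ * q ^ ((d : ℤ) - 2 * (i : ℤ))

/-- The eigenvalue `a q^(2i-d) + a⁻¹ q^(d-2i)`. -/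
def qRacahEigenvalue {K : Type*} [Field K] (d : ℕ) (a q : K) (i : ℕ) : K :=
  a * q ^ (2 * (i : ℤ) - (d : ℤ)) + a⁻¹ * q ^ ((d : ℤ) - 2 * (i : ℤ))

section QRacah

variable {K : Type*} [Field K] {d : ℕ} {a b c q x y z t : K}

lemma qRacahEigenvalue_inv (d : ℕ) (a q : K) (i : ℕ) :
    qRacahEigenvalue d a⁻¹ q⁻¹ i = qRacahEigenvalue d a q i := by
  simp only [qRacahEigenvalue, inv_inv, inv_zpow', neg_sub]
  ring

lemma neg_zpow_eq (q : K) (n : ℤ) : (-q) ^ n = (-1) ^ n * q ^ n := by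
  rw [← mul_zpow, neg_one_mul]

lemma neg_one_pow_mul_zpow_sub (d : ℕ) (m : ℤ) :
    (-1 : K) ^ d * (-1) ^ (2 * m - (d : ℤ)) = 1 := by
  rw [← zpow_natCast, ← zpow_add₀ (by simp)]
  exact Even.neg_one_zpow ⟨m, by ring⟩

lemma neg_one_pow_mul_zpow_sub' (d : ℕ) (m : ℤ) :
    (-1 : K) ^ d * (-1) ^ ((d : ℤ) - 2 * m) = 1 := by
  rw [← zpow_natCast, ← zpow_add₀ (by simp)]
  exact Even.neg_one_zpow ⟨d - m, by ring⟩

lemma neg_one_zpow_two_mul_sub (m n : ℤ) : (-1 : K) ^ (2 * m - 2 * n) = 1 :=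
  Even.neg_one_zpow ⟨m - n, by ring⟩

lemma neg_one_pow_mul_self (d : ℕ) : (-1 : K) ^ d * (-1) ^ d = 1 := by
  rw [← mul_pow]; simp

lemma neg_one_pow_inv (d : ℕ) : ((-1 : K) ^ d)⁻¹ = (-1) ^ d := by
  rw [← inv_pow]; simp

lemma qRacahEigenvalue_neg (d : ℕ) (a q : K) (i : ℕ) :
    qRacahEigenvalue d ((-1) ^ d * a) (-q) i = qRacahEigenvalue d a q i := by
  simp only [qRacahEigenvalue, neg_zpow_eq q, mul_inv, neg_one_pow_inv]
  linear_combination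
    a * q ^ (2 * (i : ℤ) - (d : ℤ)) * neg_one_pow_mul_zpow_sub (K := K) d i +
    a⁻¹ * q ^ ((d : ℤ) - 2 * (i : ℤ)) * neg_one_pow_mul_zpow_sub' (K := K) d i

lemma qRacahEigenvalue_eq (hq : q ≠ 0) (d : ℕ) (a : K) (i : ℕ) :
    qRacahEigenvalue d a q i =
      a * q ^ (-(d : ℤ)) * (q ^ 2) ^ i + a⁻¹ * q ^ (d : ℤ) * ((q ^ 2) ^ i)⁻¹ := by
  have h1 : q ^ (2 * (i : ℤ) - (d : ℤ)) = q ^ (-(d : ℤ)) * (q ^ 2) ^ i := by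
    rw [← pow_mul, ← zpow_natCast, ← zpow_add₀ hq]
    congr 1; push_cast; ring
  have h2 : q ^ ((d : ℤ) - 2 * (i : ℤ)) = q ^ (d : ℤ) * ((q ^ 2) ^ i)⁻¹ := by
    rw [← pow_mul, ← zpow_natCast, ← zpow_neg, ← zpow_add₀ hq]
    congr 1
  rw [qRacahEigenvalue, h1, h2]
  ring

lemma qRacahEigenvalue_injective (hq : q ≠ 0) (hq4 : q ^ 4 ≠ 1)
    (h0 : qRacahEigenvalue d x q 0 = qRacahEigenvalue d a q 0)
    (h1 : qRacahEigenvalue d x q 1 = qRacahEigenvalue d a q 1) : x = a := by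
  rw [qRacahEigenvalue_eq hq, qRacahEigenvalue_eq hq] at h0 h1
  have hp : q ^ (-(d : ℤ)) ≠ 0 := zpow_ne_zero _ hq
  simp only [pow_zero, inv_one, mul_one, pow_one] at h0 h1
  have hi : q ^ 2 * (q ^ 2)⁻¹ = 1 := mul_inv_cancel₀ (pow_ne_zero _ hq)
  have : (x - a) * (q ^ (-(d : ℤ)) * (q ^ 4 - 1)) = 0 := by
    linear_combination q ^ 2 * h1 - h0 - (x⁻¹ - a⁻¹) * q ^ (d : ℤ) * hi
  rcases mul_eq_zero.1 this with h | h
  · exact sub_eq_zero.1 h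
  · exact absurd h (mul_ne_zero hp (sub_ne_zero.2 hq4))

lemma qRacahEigenvalue_recurrence (hq : q ≠ 0) (d : ℕ) (a : K) :
    qRacahEigenvalue d a q 3 - qRacahEigenvalue d a q 0 =
      (q ^ 2 + 1 + (q ^ 2)⁻¹) * (qRacahEigenvalue d a q 2 - qRacahEigenvalue d a q 1) := by
  simp only [qRacahEigenvalue_eq hq]
  field_simp
  ring

lemma qRacahEigenvalue_two_ne_one (hq : q ≠ 0) (ha : a ≠ 0) (hq2 : q ^ 2 ≠ 1)
    (ha2 : a ^ 2 ≠ q ^ (2 * (d : ℤ) - 2 * 3)) :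
    qRacahEigenvalue d a q 2 - qRacahEigenvalue d a q 1 ≠ 0 := by
  intro h
  apply ha2
  simp only [qRacahEigenvalue_eq hq, zpow_neg] at h
  have e : q ^ (2 * (d : ℤ) - 2 * 3) = (q ^ (d : ℤ)) ^ 2 * (q ^ 6)⁻¹ := by
    rw [zpow_sub₀ hq, div_eq_mul_inv, ← zpow_natCast (q ^ (d : ℤ)), ← zpow_mul]
    norm_num [mul_comm]
  have hp : q ^ (d : ℤ) ≠ 0 := zpow_ne_zero _ hq
  rw [e]
  generalize q ^ (d : ℤ) = p at *
  field_simp at h ⊢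
  have : (a ^ 2 * q ^ 6 - p ^ 2) * (q ^ 2 - 1) = 0 := by
    linear_combination h
  rcases mul_eq_zero.1 this with h | h
  · linear_combination h
  · exact absurd (sub_eq_zero.1 h) hq2

lemma eq_or_eq_inv_of_qRacahEigenvalue_eq (hq : q ≠ 0) (ht : t ≠ 0) (ha : a ≠ 0)
    (hq2 : q ^ 2 ≠ 1) (ha2 : a ^ 2 ≠ q ^ (2 * (d : ℤ) - 2 * 3))
    (h : ∀ i ≤ 3, qRacahEigenvalue d x t i = qRacahEigenvalue d a q i) :
    (t = q ∨ t = -q) ∨ t = q⁻¹ ∨ t = -q⁻¹ := by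
  have hr := qRacahEigenvalue_recurrence hq d a
  have hr' := qRacahEigenvalue_recurrence ht d x
  rw [h 0 (by simp), h 1 (by simp), h 2 (by simp), h 3 (by simp), hr] at hr'
  have := mul_right_cancel₀ (qRacahEigenvalue_two_ne_one hq ha hq2 ha2) hr'
  field_simp at this
  have : (t ^ 2 - q ^ 2) * (t ^ 2 * q ^ 2 - 1) = 0 := by
    linear_combination -this
  rcases mul_eq_zero.1 this with h | h
  · exact .inl (sq_eq_sq_iff_eq_or_eq_neg.1 (sub_eq_zero.1 h))
  · refine .inr (sq_eq_sq_iff_eq_or_eq_neg.1 ?_)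
    field_simp
    linear_combination h

lemma TQRACred.inv (h : TQRACred d a b c q) : TQRACred d a⁻¹ b⁻¹ c⁻¹ q⁻¹ := by
  obtain ⟨⟨ha, hb, hc, hq⟩, h2, h3, h4⟩ := h
  refine ⟨by simp [*], fun i hi hd => ?_, fun i hi hd => ?_, fun i hi hd => ?_⟩
  · rw [inv_pow]
    simpa using h2 i hi hd
  · simpa only [inv_pow, inv_zpow, ne_eq, inv_inj] using h3 i hi hd
  · simpa only [← mul_inv, inv_zpow, ne_eq, inv_inj] using h4 i hi hd

lemma TQRACred.neg_iff (h : TQRACred d a b c q) :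
    TQRACred d ((-1) ^ d * a) ((-1) ^ d * b) ((-1) ^ d * c) (-q) ↔
      ∀ i : ℕ, 1 ≤ i → i ≤ d →
        a * b * c ≠ -q ^ ((d : ℤ) - 2 * (i : ℤ) + 1) ∧
        a⁻¹ * b * c ≠ -q ^ ((d : ℤ) - 2 * (i : ℤ) + 1) ∧
        a * b⁻¹ * c ≠ -q ^ ((d : ℤ) - 2 * (i : ℤ) + 1) ∧
        a * b * c⁻¹ ≠ -q ^ ((d : ℤ) - 2 * (i : ℤ) + 1) := by
  obtain ⟨⟨ha, hb, hc, hq⟩, h2, h3, h4⟩ := h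
  have key : ∀ (i : ℕ) (u v w : K),
      (-1) ^ d * u * ((-1) ^ d * v) * ((-1) ^ d * w) = (-q) ^ ((d : ℤ) - 2 * (i : ℤ) + 1) ↔
        u * v * w = -q ^ ((d : ℤ) - 2 * (i : ℤ) + 1) := by
    intro i u v w
    have hs := neg_one_pow_mul_self (K := K) d
    have hz := neg_one_pow_mul_zpow_sub' (K := K) d i
    have hs0 : (-1 : K) ^ d ≠ 0 := by simp
    have e : (-1 : K) ^ ((d : ℤ) - 2 * (i : ℤ)) = (-1) ^ d :=
      mul_left_cancel₀ hs0 (hz.trans hs.symm)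
    rw [neg_zpow_eq, zpow_add₀ (by simp : (-1 : K) ≠ 0), e, zpow_one, ← mul_right_inj' hs0]
    generalize (-1 : K) ^ d = s at *
    constructor <;> intro h
    · linear_combination h - ((s ^ 2 + 1) * (u * v * w) + q ^ ((d : ℤ) - 2 * i + 1)) * hs
    · linear_combination h + ((s ^ 2 + 1) * (u * v * w) + q ^ ((d : ℤ) - 2 * i + 1)) * hs
  constructor
  · rintro ⟨-, -, -, h⟩ i hi hd
    simpa only [mul_inv, neg_one_pow_inv, ne_eq, key] using h i hi hd
  · intro h
    refine ⟨by simp [*], fun i hi hd => ?_, fun i hi hd => ?_, fun i hi hd => ?_⟩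
    · rw [pow_mul, neg_sq, ← pow_mul]
      exact h2 i hi hd
    · simpa only [mul_pow, sq ((-1 : K) ^ d), neg_one_pow_mul_self, one_mul, neg_zpow_eq q,
        neg_one_zpow_two_mul_sub] using h3 i hi hd
    · simpa only [mul_inv, neg_one_pow_inv, ne_eq, key] using h i hi hd

lemma isTwin_iff : IsTwin d a b c q x y z t ↔ TQRACred d x y z t ∧ ∀ i ≤ d,
    qRacahEigenvalue d x t i = qRacahEigenvalue d a q i ∧
    qRacahEigenvalue d y t i = qRacahEigenvalue d b q i ∧
    qRacahEigenvalue d z t i = qRacahEigenvalue d c q i := Iff.rfl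

lemma eq_of_qRacahEigenvalue_eq (hd : 2 ≤ d) (h : TQRACred d a b c q)
    (ht : ∀ i ≤ d, qRacahEigenvalue d x q i = qRacahEigenvalue d a q i ∧
      qRacahEigenvalue d y q i = qRacahEigenvalue d b q i ∧
      qRacahEigenvalue d z q i = qRacahEigenvalue d c q i) :
    x = a ∧ y = b ∧ z = c := by
  have hq4 : q ^ 4 ≠ 1 := h.2.1 2 (by norm_num) hd
  have hq := h.1.2.2.2
  have h0 := ht 0 (by lia)
  have h1 := ht 1 (by lia)
  exact ⟨qRacahEigenvalue_injective hq hq4 h0.1 h1.1,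
    qRacahEigenvalue_injective hq hq4 h0.2.1 h1.2.1,
    qRacahEigenvalue_injective hq hq4 h0.2.2 h1.2.2⟩

lemma neg_one_pow_mul_cancel (d : ℕ) (a : K) : (-1) ^ d * ((-1) ^ d * a) = a := by
  rw [← mul_assoc, neg_one_pow_mul_self, one_mul]

lemma eq_neg_one_pow_mul (h : (-1) ^ d * x = a) : x = (-1) ^ d * a := by
  rw [← h, neg_one_pow_mul_cancel]

/-- The twins of `(a, b, c; q)`, with the sign-changed ones subject to membership. -/
lemma isTwin_iff_of_TQRACred (hd : 3 ≤ d) (h : TQRACred d a b c q) :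
    IsTwin d a b c q x y z t ↔
      ((x, y, z, t) = (a, b, c, q) ∨ (x, y, z, t) = (a⁻¹, b⁻¹, c⁻¹, q⁻¹)) ∨
      TQRACred d ((-1) ^ d * a) ((-1) ^ d * b) ((-1) ^ d * c) (-q) ∧
        ((x, y, z, t) = ((-1) ^ d * a, (-1) ^ d * b, (-1) ^ d * c, -q) ∨
         (x, y, z, t) = ((-1) ^ d * a⁻¹, (-1) ^ d * b⁻¹, (-1) ^ d * c⁻¹, -q⁻¹)) := by
  have inv_neg_one_pow_mul : ∀ u : K, ((-1) ^ d * u)⁻¹ = (-1) ^ d * u⁻¹ := fun u => by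
    rw [mul_inv, neg_one_pow_inv]
  have hd2 : 2 ≤ d := by lia
  rw [isTwin_iff]
  simp only [Prod.mk.injEq]
  constructor
  · rintro ⟨hT, hE⟩
    have hq2 : q ^ 2 ≠ 1 := h.2.1 1 le_rfl (by lia)
    have ha2 : a ^ 2 ≠ q ^ (2 * (d : ℤ) - 2 * 3) :=
      (h.2.2.1 3 (by norm_num) (by lia)).1
    rcases eq_or_eq_inv_of_qRacahEigenvalue_eq h.1.2.2.2 hT.1.2.2.2 h.1.1 hq2 ha2
      (fun i hi => (hE i (hi.trans hd)).1) with (rfl | rfl) | rfl | rfl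
    · obtain ⟨rfl, rfl, rfl⟩ := eq_of_qRacahEigenvalue_eq hd2 h hE
      simp
    · have := eq_of_qRacahEigenvalue_eq (x := (-1) ^ d * x) (y := (-1) ^ d * y)
        (z := (-1) ^ d * z) hd2 h fun i hi => by
          simpa only [neg_neg, ← qRacahEigenvalue_neg d _ (-q)] using hE i hi
      obtain ⟨rfl, rfl, rfl⟩ := And.imp eq_neg_one_pow_mul
        (And.imp eq_neg_one_pow_mul eq_neg_one_pow_mul) this
      exact .inr ⟨hT, .inl ⟨rfl, rfl, rfl, rfl⟩⟩
    · have := eq_of_qRacahEigenvalue_eq (x := x⁻¹) (y := y⁻¹) (z := z⁻¹) hd2 h fun i hi => by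
          simpa only [inv_inv, ← qRacahEigenvalue_inv d _ q⁻¹] using hE i hi
      obtain ⟨rfl, rfl, rfl⟩ := this
      simp
    · have := eq_of_qRacahEigenvalue_eq (x := (-1) ^ d * x) (y := (-1) ^ d * y)
        (z := (-1) ^ d * z) hd2 h.inv fun i hi => by
          simpa only [neg_neg, qRacahEigenvalue_inv d _ q, ← qRacahEigenvalue_neg d _ (-q⁻¹)]
            using hE i hi
      obtain ⟨rfl, rfl, rfl⟩ := And.imp eq_neg_one_pow_mul
        (And.imp eq_neg_one_pow_mul eq_neg_one_pow_mul) this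
      refine .inr ⟨?_, .inr ⟨rfl, rfl, rfl, rfl⟩⟩
      simpa only [inv_neg_one_pow_mul, inv_neg, inv_inv] using hT.inv
  · rintro ((⟨rfl, rfl, rfl, rfl⟩ | ⟨rfl, rfl, rfl, rfl⟩) |
      ⟨hT, ⟨rfl, rfl, rfl, rfl⟩ | ⟨rfl, rfl, rfl, rfl⟩⟩)
    · exact ⟨h, by simp⟩
    · exact ⟨h.inv, by simp [qRacahEigenvalue_inv]⟩
    · exact ⟨hT, by simp [qRacahEigenvalue_neg]⟩
    · exact ⟨by simpa only [inv_neg_one_pow_mul, inv_neg] using hT.inv,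
        by simp [qRacahEigenvalue_neg, qRacahEigenvalue_inv]⟩

end QRacah

/-- Theorem 15.3: classification of the twins of (a,b,c;q) in T-QRAC_red. -/
theorem stmt_18 {K : Type*} [Field K] [IsAlgClosed K] (d : ℕ) (hd : 3 ≤ d)
    (a b c q : K) (h : TQRACred d a b c q) :
    ((∀ i : ℕ, 1 ≤ i → i ≤ d →
        a * b * c ≠ -q ^ ((d : ℤ) - 2 * (i : ℤ) + 1) ∧
        a⁻¹ * b * c ≠ -q ^ ((d : ℤ) - 2 * (i : ℤ) + 1) ∧
        a * b⁻¹ * c ≠ -q ^ ((d : ℤ) - 2 * (i : ℤ) + 1) ∧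
        a * b * c⁻¹ ≠ -q ^ ((d : ℤ) - 2 * (i : ℤ) + 1)) →
      ∀ x y z t : K, IsTwin d a b c q x y z t ↔
        ((x, y, z, t) = (a, b, c, q) ∨
         (x, y, z, t) = (a⁻¹, b⁻¹, c⁻¹, q⁻¹) ∨
         (x, y, z, t) = ((-1) ^ d * a, (-1) ^ d * b, (-1) ^ d * c, -q) ∨
         (x, y, z, t) = ((-1) ^ d * a⁻¹, (-1) ^ d * b⁻¹, (-1) ^ d * c⁻¹, -q⁻¹))) ∧
    ((∃ i : ℕ, 1 ≤ i ∧ i ≤ d ∧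
        (a * b * c = -q ^ ((d : ℤ) - 2 * (i : ℤ) + 1) ∨
         a⁻¹ * b * c = -q ^ ((d : ℤ) - 2 * (i : ℤ) + 1) ∨
         a * b⁻¹ * c = -q ^ ((d : ℤ) - 2 * (i : ℤ) + 1) ∨
         a * b * c⁻¹ = -q ^ ((d : ℤ) - 2 * (i : ℤ) + 1))) →
      ∀ x y z t : K, IsTwin d a b c q x y z t ↔
        ((x, y, z, t) = (a, b, c, q) ∨
         (x, y, z, t) = (a⁻¹, b⁻¹, c⁻¹, q⁻¹))) := by
  refine ⟨fun hn x y z t => ?_, fun ⟨i, hi, hid, he⟩ x y z t => ?_⟩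
  · rw [isTwin_iff_of_TQRACred hd h, h.neg_iff]
    tauto
  · rw [isTwin_iff_of_TQRACred hd h, h.neg_iff]
    refine or_iff_left fun hn => ?_
    obtain ⟨h1, h2, h3, h4⟩ := hn.1 i hi hid
    tauto
end
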